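/- Let h = 0 and β > β_c. The Schonmann projection ν_{β,0}^+ is φ-mixing: lim_{n→∞} sup_{B ∈ ℱ_{>n}} sup_{A ∈ ℱ_{<0}, ν_{β,0}^+(A) > 0} | ν_{β,0}^+(B | A) − ν_{β,0}^+(B) | = 0, where ℱ_{<0} is the σ-algebra on Ω = {−1,+1}^ℤ generated by the coordinates with index < 0 and ℱ_{>n} is the σ-algebra generated by the coordinates with index ≥ n. -/

import Mathlib

open MeasureTheory Filter Topology ProbabilityTheory

noncomputable section

/-- Spin value of a Boolean spin: `true ↦ +1`, `false ↦ -1`. -/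
def sval (b : Bool) : ℝ := if b then 1 else -1

/-- Two-dimensional spin configurations. -/
abbrev Cfg2 := ℤ × ℤ → Bool

/-- Two-sided sequences over an alphabet `A`. -/
abbrev ZSeq (A : Type*) := ℤ → A

/-- Pasts: index `k` corresponds to the coordinate `-(k+1)`. -/
abbrev Past (A : Type*) := ℕ → A

/-- The four nearest neighbours of a site of `ℤ²`. -/
def nbrs (x : ℤ × ℤ) : Finset (ℤ × ℤ) :=
  {(x.1 + 1, x.2), (x.1 - 1, x.2), (x.1, x.2 + 1), (x.1, x.2 - 1)}

/-- Boltzmann weight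
`exp(β[Σ_{{x,y}⊆Λ, x∼y} ω_x ω_y + Σ_{x∈Λ, y∉Λ, x∼y} ω_x σ_y] − h Σ_{x∈Λ} ω_x)`
(the sum over unordered pairs inside `Λ` is written as half the ordered sum). -/
def isingWeight (β h : ℝ) (Λ : Finset (ℤ × ℤ)) (σ ω : Cfg2) : ℝ :=
  Real.exp (β * ((∑ x ∈ Λ, ∑ y ∈ Λ.filter (fun y => y ∈ nbrs x),
        sval (ω x) * sval (ω y)) / 2
      + ∑ x ∈ Λ, ∑ y ∈ (nbrs x).filter (fun y => y ∉ Λ), sval (ω x) * sval (σ y))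
    - h * ∑ x ∈ Λ, sval (ω x))

/-- Fill in the values `τ` inside `Λ` and `σ` outside. -/
def fill (Λ : Finset (ℤ × ℤ)) (σ : Cfg2) (τ : ↥Λ → Bool) : Cfg2 :=
  fun x => if hx : x ∈ Λ then τ ⟨x, hx⟩ else σ x

/-- The finite-volume Ising measure in `Λ` with boundary condition `σ`, viewed as a measure on
the full configuration space, the spins outside `Λ` being frozen to `σ`. -/
def isingFV (β h : ℝ) (Λ : Finset (ℤ × ℤ)) (σ : Cfg2) : Measure Cfg2 :=
  (∑ τ : ↥Λ → Bool, ENNReal.ofReal (isingWeight β h Λ σ (fill Λ σ τ)))⁻¹ •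
    ∑ τ : ↥Λ → Bool,
      ENNReal.ofReal (isingWeight β h Λ σ (fill Λ σ τ)) • Measure.dirac (fill Λ σ τ)

/-- The box `[-n,n]²`. -/
def box (n : ℕ) : Finset (ℤ × ℤ) :=
  (Finset.Icc (-(n : ℤ)) (n : ℤ)) ×ˢ (Finset.Icc (-(n : ℤ)) (n : ℤ))

/-- Convergence of a sequence of measures on a product space in the sense of convergence of the
measures of all finite-dimensional cylinder events; for probability measures on `{−1,+1}^ι`
this is exactly weak convergence. -/
def CylTendsto {ι A : Type*} [MeasurableSpace A] (μs : ℕ → Measure (ι → A))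
    (μ : Measure (ι → A)) : Prop :=
  ∀ (s : Finset ι) (f : ι → A),
    Tendsto (fun n => μs n {η | ∀ i ∈ s, η i = f i}) atTop (𝓝 (μ {η | ∀ i ∈ s, η i = f i}))

/-- `μ` is the plus phase `μ_{β,h}^+`: the weak limit of the finite-volume Ising measures on
`[-n,n]²` with all-plus boundary conditions. -/
def IsPlusPhase (β h : ℝ) (μ : Measure Cfg2) : Prop :=
  IsProbabilityMeasure μ ∧ CylTendsto (fun n => isingFV β h (box n) (fun _ => true)) μ

/-- `μ` is the minus phase `μ_{β,h}^-`. -/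
def IsMinusPhase (β h : ℝ) (μ : Measure Cfg2) : Prop :=
  IsProbabilityMeasure μ ∧ CylTendsto (fun n => isingFV β h (box n) (fun _ => false)) μ

/-- The critical inverse temperature `β_c = ln(1+√2)/2`. -/
def betaCrit : ℝ := Real.log (1 + Real.sqrt 2) / 2

/-- Projection of a two-dimensional configuration onto the line `ℤ × {0}`. -/
def lineProj (η : Cfg2) : ZSeq Bool := fun i => η (i, 0)

/-- The Schonmann projection of a measure on `{−1,+1}^{ℤ²}`. -/
def schonmann (μ : Measure Cfg2) : Measure (ZSeq Bool) := μ.map lineProj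

/-- Restriction of a two-sided sequence to its strict past; index `k` is coordinate `-(k+1)`. -/
def restrictPast {A : Type*} (ω : ZSeq A) : Past A := fun k => ω (-(k + 1 : ℤ))

/-- The shift on two-sided sequences. -/
def shiftSeq {A : Type*} : ZSeq A → ZSeq A := fun ω i => ω (i + 1)

/-- The σ-algebra `ℱ_{<0}` generated by the coordinates of negative index. -/
def pastSigma (A : Type*) [MeasurableSpace A] : MeasurableSpace (ZSeq A) :=
  MeasurableSpace.comap (fun ω : ZSeq A => restrictPast ω) inferInstance

/-- The σ-algebra generated by the coordinates in `S`. -/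
def sigmaOn {ι A : Type*} [MeasurableSpace A] (S : Set ι) : MeasurableSpace (ι → A) :=
  MeasurableSpace.comap (fun ω : ι → A => S.restrict ω) inferInstance

/-- A g-function on the alphabet `A`: measurable, `[0,1]`-valued, normalized. -/
def IsGFunction {A : Type*} [Fintype A] [MeasurableSpace A] (P : A → Past A → ℝ) : Prop :=
  (∀ a, Measurable (P a)) ∧ ∀ ω, (∑ a : A, P a ω) = 1 ∧ ∀ a, P a ω ∈ Set.Icc (0 : ℝ) 1

/-- `μ` is a translation-invariant g-measure consistent with the g-function `P`: for each `a`,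
`ω ↦ P a (restrictPast ω)` is a version of the conditional probability `μ(X₀ = a | ℱ_{<0})`. -/
def IsGMeasure {A : Type*} [MeasurableSpace A] (μ : Measure (ZSeq A))
    (P : A → Past A → ℝ) : Prop :=
  IsProbabilityMeasure μ ∧ μ.map shiftSeq = μ ∧
    ∀ a : A, (fun ω => P a (restrictPast ω))
      =ᵐ[μ] μ[Set.indicator {ω : ZSeq A | ω 0 = a} (fun _ => (1 : ℝ)) | pastSigma A]

/-- The `k`-th variation of a g-function: the supremum of `|P a ω − P a σ|` over pasts agreeing
on the coordinates `−k,…,−1`. -/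
def varG {A : Type*} (P : A → Past A → ℝ) (k : ℕ) : ℝ :=
  sSup {d : ℝ | ∃ (a : A) (ω σ' : Past A), (∀ j < k, ω j = σ' j) ∧ d = |P a ω - P a σ'|}

/-- Elementary conditional probability `μ(B | A)`, as a real number. -/
def condProbR {X : Type*} [MeasurableSpace X] (μ : Measure X) (B A : Set X) : ℝ :=
  ((μ[|A]) B).toReal

/-- The event that `η_i = ω` (suitably reindexed) for `−n ≤ i ≤ −1` and `η_i = b`
for `−(n+l) ≤ i ≤ −(n+1)`. -/
def pastEvt (n l : ℕ) (b : Bool) (ω : Past Bool) : Set (ZSeq Bool) :=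
  {η | (∀ i : ℤ, -(n : ℤ) ≤ i → i ≤ -1 → η i = ω (i.natAbs - 1)) ∧
       (∀ i : ℤ, -((n : ℤ) + l) ≤ i → i ≤ -((n : ℤ) + 1) → η i = b)}

/-- The event that `η_i = b` for `−(n+l) ≤ i ≤ −n`. -/
def blockEvt (n l : ℕ) (b : Bool) : Set (ZSeq Bool) :=
  {η | ∀ i : ℤ, -((n : ℤ) + l) ≤ i → i ≤ -(n : ℤ) → η i = b}

/-- The event that `η_i = b` for `−n ≤ i ≤ −1`. -/
def allBlock (n : ℕ) (b : Bool) : Set (ZSeq Bool) :=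
  {η | ∀ i : ℤ, -(n : ℤ) ≤ i → i ≤ -1 → η i = b}

/-- `P` is the g-function `P^{+,b}` obtained from `ν` by conditioning on the symbol `b`
in the far past: `P(a|ω) = lim_n lim_l ν(η₀ = a | η = b on [−(n+l),−(n+1)], η = ω on [−n,−1])`,
both iterated limits being required to exist. -/
def IsCondG (ν : Measure (ZSeq Bool)) (b : Bool) (P : Bool → Past Bool → ℝ) : Prop :=
  ∀ (a : Bool) (ω : Past Bool), ∃ L : ℕ → ℝ,
    (∀ n, Tendsto (fun l => condProbR ν {η | η 0 = a} (pastEvt n l b ω)) atTop (𝓝 (L n))) ∧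
    Tendsto L atTop (𝓝 (P a ω))

/-- `ν'` is the iterated weak limit `lim_n lim_l ν( · | η = b on [−(n+l),−n])`. -/
def IsCondLimitMeasure (ν : Measure (ZSeq Bool)) (b : Bool) (ν' : Measure (ZSeq Bool)) : Prop :=
  ∃ νseq : ℕ → Measure (ZSeq Bool),
    (∀ n, CylTendsto (fun l => ν[|blockEvt n l b]) (νseq n)) ∧ CylTendsto νseq ν'

/-- Stochastic domination: `ν ≤ μ` iff `ν B ≤ μ B` for every increasing measurable event `B`. -/
def StochDom {A : Type*} [MeasurableSpace A] [Preorder A]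
    (ν μ : Measure (ZSeq A)) : Prop :=
  ∀ B : Set (ZSeq A), MeasurableSet B → (∀ ⦃x y : ZSeq A⦄, x ≤ y → x ∈ B → y ∈ B) → ν B ≤ μ B

/-- `π` is the i.i.d. product measure with `π(η_i = +1) = ρ` for each coordinate. -/
def IsBernoulliProd (ρ : ℝ) (π : Measure (ZSeq Bool)) : Prop :=
  IsProbabilityMeasure π ∧ ∀ (s : Finset ℤ) (f : ℤ → Bool),
    π {η | ∀ i ∈ s, η i = f i} = ∏ i ∈ s, ENNReal.ofReal (if f i then ρ else 1 - ρ)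

/-- Splicing of pasts: coordinates `−k,…,−1` (indices `< k`) from `ω`, the rest from `σ`. -/
def splice {A : Type*} (σ ω : Past A) (k : ℕ) : Past A := fun j => if j < k then ω j else σ j

/-- `ν'` is an extreme point of the convex set of g-measures consistent with `P`. -/
def ExtremeGMeasure (ν' : Measure (ZSeq Bool)) (P : Bool → Past Bool → ℝ) : Prop :=
  IsGMeasure ν' P ∧
  ∀ ν₁ ν₂ : Measure (ZSeq Bool), IsGMeasure ν₁ P → IsGMeasure ν₂ P →
    ∀ t : ℝ, t ∈ Set.Ioo (0 : ℝ) 1 →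
      ν' = ENNReal.ofReal t • ν₁ + ENNReal.ofReal (1 - t) • ν₂ → ν₁ = ν' ∧ ν₂ = ν'

/-- The event that the spins on the line are `−1` on `{−m,…,−n} × {0}`. -/
def lineMinusEvt (n m : ℕ) : Set Cfg2 :=
  {η | ∀ i : ℤ, -(m : ℤ) ≤ i → i ≤ -(n : ℤ) → η (i, 0) = false}

/-- Nearest-neighbour adjacency in `ℤ²` (`‖x−y‖₁ = 1`). -/
def adj2 (x y : ℤ × ℤ) : Prop := (x.1 - y.1).natAbs + (x.2 - y.2).natAbs = 1

/-- The event `A_n`: there is an infinite nearest-neighbour path of `+1` spins starting at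
`(n,0)` entirely contained in the half-plane `{x ≤ n}`. -/
def plusPathEvt (n : ℕ) : Set Cfg2 :=
  {η | ∃ γ : ℕ → ℤ × ℤ, γ 0 = ((n : ℤ), 0) ∧ (∀ j, adj2 (γ j) (γ (j + 1))) ∧
    Function.Injective γ ∧ (∀ j, (γ j).1 ≤ (n : ℤ)) ∧ ∀ j, η (γ j) = true}

/-- The block map for the decimation `ν_{l,k}`: the `j`-th letter consists of the spins on
`[j(k+l), j(k+l)+l−1]`. -/
def blockMap (l k : ℕ) (η : ZSeq Bool) : ZSeq (Fin l → Bool) :=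
  fun j r => η (j * ((k : ℤ) + l) + r)

end

namespace Schonmann

open Finset

/-- A sum over an integer interval is dominated by a shifted sum. -/
theorem sum_Icc_le_shift_right {lo hi : ℤ} {f g : ℤ → ℝ}
    (hlt : ∀ k, lo ≤ k → k < hi → f k ≤ g (k + 1))
    (htop : f hi ≤ 0) (hg : ∀ k, 0 ≤ g k) : ∑ k ∈ Icc lo hi, f k ≤ ∑ k ∈ Icc lo hi, g k := by
  rcases lt_or_ge hi lo with h | h
  · simp [Icc_eq_empty (not_le.2 h)]
  have h1 : Icc lo hi = insert hi (Ico lo hi) := by ext; simp; omega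
  have h2 : Icc lo hi = insert lo (Ioc lo hi) := by ext; simp; omega
  have h3 : ∑ k ∈ Ico lo hi, g (k + 1) = ∑ k ∈ Ioc lo hi, g k := by
    refine sum_bij (fun k _ => k + 1) ?_ ?_ ?_ ?_
    · intro k hk; simp at hk ⊢; omega
    · intro a _ b _ hab; simpa using hab
    · intro k hk; exact ⟨k - 1, by simp at hk ⊢; omega, by ring⟩
    · intros; rfl
  have h4 : ∑ k ∈ Ico lo hi, f k ≤ ∑ k ∈ Ico lo hi, g (k + 1) :=
    sum_le_sum fun k hk => by simp at hk; exact hlt k hk.1 hk.2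
  rw [h1, sum_insert (by simp)]
  rw [← h1, h2, sum_insert (by simp)]
  linarith [hg lo]

theorem sum_Icc_le_shift_left {lo hi : ℤ} {f g : ℤ → ℝ}
    (hlt : ∀ k, lo < k → k ≤ hi → f k ≤ g (k - 1))
    (hbot : f lo ≤ 0) (hg : ∀ k, 0 ≤ g k) : ∑ k ∈ Icc lo hi, f k ≤ ∑ k ∈ Icc lo hi, g k := by
  have hneg : ∀ u : ℤ → ℝ, ∑ k ∈ Icc lo hi, u k = ∑ k ∈ Icc (-hi) (-lo), u (-k) := by
    intro u
    refine sum_bij (fun k _ => -k) ?_ ?_ ?_ ?_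
    · intro k hk; simp at hk ⊢; omega
    · intro a _ b _ hab; simpa using hab
    · intro k hk; exact ⟨-k, by simp at hk ⊢; omega, by ring⟩
    · intros; simp
  rw [hneg f, hneg g]
  refine sum_Icc_le_shift_right (fun k h1 h2 => ?_) (by simpa using hbot) fun k => hg _
  have := hlt (-k) (by omega) (by omega)
  rwa [show -k - 1 = -(k + 1) by ring] at this

/-- The linear relations satisfied by the corner observables of a rectangle: `x i j v` is the value
at the corner of the face with lower left vertex `(i, j)` next to the vertex `v`. -/
structure IsCornerSol (t : ℝ) (a b T : ℤ) (x : ℤ → ℤ → ℤ × ℤ → ℝ) (src : ℤ → ℝ) : Prop where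
  horSum : ∀ i j, a - 1 ≤ i → i ≤ b → 1 ≤ j → j ≤ T →
    x i j (i, j) + x i j (i + 1, j) = t * (x i (j - 1) (i, j) + x i (j - 1) (i + 1, j))
  horSub : ∀ i j, a - 1 ≤ i → i ≤ b → 1 ≤ j → j ≤ T →
    x i (j - 1) (i, j) - x i (j - 1) (i + 1, j) = t * (x i j (i, j) - x i j (i + 1, j))
  verSub : ∀ i j, a ≤ i → i ≤ b → 0 ≤ j → j ≤ T →
    x i j (i, j + 1) - x i j (i, j) = t * (x (i - 1) j (i, j) + x (i - 1) j (i, j + 1))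
  verSum : ∀ i j, a ≤ i → i ≤ b → 0 ≤ j → j ≤ T →
    x (i - 1) j (i, j + 1) - x (i - 1) j (i, j) = t * (x i j (i, j) + x i j (i, j + 1))
  left : ∀ j, 0 ≤ j → j ≤ T → x (a - 1) j (a - 1, j) = x (a - 1) j (a - 1, j + 1)
  right : ∀ j, 0 ≤ j → j ≤ T → x b j (b + 1, j) = x b j (b + 1, j + 1)
  top : ∀ i, a - 1 ≤ i → i ≤ b → x i T (i, T + 1) = x i T (i + 1, T + 1)
  bottom : ∀ i, a - 1 ≤ i → i ≤ b → x i 0 (i, 0) + x i 0 (i + 1, 0) = src i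

theorem IsCornerSol.sub_sum {ι : Type*} {t : ℝ} {a b T : ℤ} {x : ℤ → ℤ → ℤ × ℤ → ℝ} {src : ℤ → ℝ}
    (hx : IsCornerSol t a b T x src) (s : Finset ι) (c : ι → ℝ) (y : ι → ℤ → ℤ → ℤ × ℤ → ℝ)
    (r : ι → ℤ → ℝ) (hy : ∀ k ∈ s, IsCornerSol t a b T (y k) (r k)) :
    IsCornerSol t a b T (fun i j v => x i j v - ∑ k ∈ s, c k * y k i j v)
      (fun i => src i - ∑ k ∈ s, c k * r k i) := by
  classical
  induction s using Finset.induction_on with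
  | empty => simpa using hx
  | insert k s hk ih =>
    have h1 := ih fun l hl => hy l (mem_insert_of_mem hl)
    have h2 := hy k (mem_insert_self k s)
    simp only [sum_insert hk]
    constructor
    · intro i j e1 e2 e3 e4
      linear_combination h1.horSum i j e1 e2 e3 e4 - c k * h2.horSum i j e1 e2 e3 e4
    · intro i j e1 e2 e3 e4
      linear_combination h1.horSub i j e1 e2 e3 e4 - c k * h2.horSub i j e1 e2 e3 e4
    · intro i j e1 e2 e3 e4
      linear_combination h1.verSub i j e1 e2 e3 e4 - c k * h2.verSub i j e1 e2 e3 e4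
    · intro i j e1 e2 e3 e4
      linear_combination h1.verSum i j e1 e2 e3 e4 - c k * h2.verSum i j e1 e2 e3 e4
    · intro j e1 e2
      linear_combination h1.left j e1 e2 - c k * h2.left j e1 e2
    · intro j e1 e2
      linear_combination h1.right j e1 e2 - c k * h2.right j e1 e2
    · intro i e1 e2
      linear_combination h1.top i e1 e2 - c k * h2.top i e1 e2
    · intro i e1 e2
      linear_combination h1.bottom i e1 e2 - c k * h2.bottom i e1 e2

/-- Antiperiodic four-cycle inequality: sums are controlled by differences. -/
theorem antiperiodic_sum_le (p q r s : ℝ) :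
    (p + q) ^ 2 + (q + r) ^ 2 + (r + s) ^ 2 + (s - p) ^ 2 ≤
      (3 + 2 * √2) * ((q - p) ^ 2 + (r - q) ^ 2 + (s - r) ^ 2 + (p + s) ^ 2) := by
  have h2 : √2 ^ 2 = 2 := Real.sq_sqrt (by norm_num)
  have h0 : 0 ≤ √2 := Real.sqrt_nonneg 2
  have key : 0 ≤ (√2 * p - (q - s)) ^ 2 + (√2 * r - (q + s)) ^ 2 := by positivity
  have key2 : p * q + q * r + r * s - s * p ≤ √2 / 2 * (p ^ 2 + q ^ 2 + r ^ 2 + s ^ 2) := by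
    have h3 : 0 ≤ 2 * (p ^ 2 + q ^ 2 + r ^ 2 + s ^ 2) -
        2 * √2 * (p * q + q * r + r * s - s * p) := by
      refine key.trans (le_of_eq ?_)
      linear_combination (p ^ 2 + r ^ 2) * h2
    have h4 := mul_nonneg h0 h3
    have h5 : √2 * (2 * √2 * (p * q + q * r + r * s - s * p)) =
        4 * (p * q + q * r + r * s - s * p) := by
      linear_combination 2 * (p * q + q * r + r * s - s * p) * h2
    linarith
  nlinarith [mul_nonneg h0 (sub_nonneg.2 key2)]

/-- The four differences around a face, squared and summed. -/
def faceDiff (x : ℤ → ℤ → ℤ × ℤ → ℝ) (i j : ℤ) : ℝ :=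
  (x i j (i, j + 1) - x i j (i, j)) ^ 2 + (x i j (i + 1, j + 1) - x i j (i, j + 1)) ^ 2 +
    (x i j (i + 1, j) - x i j (i + 1, j + 1)) ^ 2 + (x i j (i, j) + x i j (i + 1, j)) ^ 2

theorem faceDiff_nonneg (x : ℤ → ℤ → ℤ × ℤ → ℝ) (i j : ℤ) : 0 ≤ faceDiff x i j := by
  unfold faceDiff; positivity

theorem IsCornerSol.energy_le {t θ ρ : ℝ} {a b T : ℤ} {x : ℤ → ℤ → ℤ × ℤ → ℝ} {src : ℤ → ℝ}
    (hx : IsCornerSol t a b T x src) (hT : 0 ≤ T) (hρ : 1 ≤ ρ)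
    (hθ : t ^ 2 * ρ * (3 + 2 * √2) ≤ θ) (W : ℤ → ℝ) (hW : ∀ i, 0 ≤ W i)
    (hW1 : ∀ i, W i ≤ ρ * W (i + 1)) (hW2 : ∀ i, W i ≤ ρ * W (i - 1)) :
    (1 - θ) * ∑ i ∈ Icc (a - 1) b, ∑ j ∈ Icc 0 T, W i * faceDiff x i j ≤
      ∑ i ∈ Icc (a - 1) b, W i * src i ^ 2 := by
  have hWρ : ∀ i, W i ≤ ρ * W i := fun i => le_mul_of_one_le_left (hW i) hρ
  have hρ0 : 0 ≤ ρ := by linarith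
  set c := t ^ 2 * ρ
  have hc : 0 ≤ c := by positivity
  -- west
  have west : ∑ i ∈ Icc (a - 1) b, ∑ j ∈ Icc 0 T, W i * (x i j (i, j + 1) - x i j (i, j)) ^ 2 ≤
      ∑ i ∈ Icc (a - 1) b, ∑ j ∈ Icc 0 T, c * W i *
          (x i j (i + 1, j + 1) + x i j (i + 1, j)) ^ 2 := by
    refine sum_Icc_le_shift_left (fun i h1 h2 => ?_) ?_ fun i => sum_nonneg fun j _ => ?_
    · refine sum_le_sum fun j hj => ?_
      simp only [mem_Icc] at hj
      rw [hx.verSub i j (by omega) h2 hj.1 hj.2, show i - 1 + 1 = i by ring]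
      have := mul_le_mul_of_nonneg_right (hW2 i)
          (sq_nonneg (t * (x (i - 1) j (i, j) + x (i - 1) j (i, j + 1))))
      calc _ ≤ _ := this
        _ = _ := by ring
    · refine (sum_eq_zero fun j hj => ?_).le
      simp only [mem_Icc] at hj
      rw [hx.left j hj.1 hj.2]; ring
    · have := hW i; positivity
  have east : ∑ i ∈ Icc (a - 1) b, ∑ j ∈ Icc 0 T, W i *
      (x i j (i + 1, j) - x i j (i + 1, j + 1)) ^ 2 ≤
      ∑ i ∈ Icc (a - 1) b, ∑ j ∈ Icc 0 T, c * W i * (x i j (i, j + 1) + x i j (i, j)) ^ 2 := by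
    refine sum_Icc_le_shift_right (fun i h1 h2 => ?_) ?_ fun i => sum_nonneg fun j _ => ?_
    · refine sum_le_sum fun j hj => ?_
      simp only [mem_Icc] at hj
      have h := hx.verSum (i + 1) j (by omega) (by omega) hj.1 hj.2
      rw [show i + 1 - 1 = i by ring] at h
      rw [show x i j (i + 1, j) - x i j (i + 1, j + 1) =
        -(t * (x (i + 1) j (i + 1, j) + x (i + 1) j (i + 1, j + 1))) by rw [← h]; ring]
      have := mul_le_mul_of_nonneg_right (hW1 i)
        (sq_nonneg (t * (x (i + 1) j (i + 1, j) + x (i + 1) j (i + 1, j + 1))))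
      calc _ = _ := by rw [neg_sq]
        _ ≤ _ := this
        _ = _ := by ring
    · refine (sum_eq_zero fun j hj => ?_).le
      simp only [mem_Icc] at hj
      rw [hx.right j hj.1 hj.2]; ring
    · have := hW i; positivity
  have north : ∑ i ∈ Icc (a - 1) b, ∑ j ∈ Icc 0 T, W i *
      (x i j (i + 1, j + 1) - x i j (i, j + 1)) ^ 2 ≤
      ∑ i ∈ Icc (a - 1) b, ∑ j ∈ Icc 0 T, c * W i * (x i j (i + 1, j) - x i j (i, j)) ^ 2 := by
    refine sum_le_sum fun i hi => ?_
    simp only [mem_Icc] at hi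
    refine sum_Icc_le_shift_right (fun j h1 h2 => ?_) ?_ fun j => ?_
    · have h := hx.horSub i (j + 1) hi.1 hi.2 (by omega) (by omega)
      rw [show j + 1 - 1 = j by ring] at h
      rw [show x i j (i + 1, j + 1) - x i j (i, j + 1) =
        -(t * (x i (j + 1) (i, j + 1) - x i (j + 1) (i + 1, j + 1))) by rw [← h]; ring]
      have := mul_le_mul_of_nonneg_right (hWρ i)
        (sq_nonneg (t * (x i (j + 1) (i, j + 1) - x i (j + 1) (i + 1, j + 1))))
      calc _ = _ := by rw [neg_sq]
        _ ≤ _ := this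
        _ = _ := by ring
    · rw [hx.top i hi.1 hi.2]; simp
    · have := hW i; positivity
  have south : ∑ i ∈ Icc (a - 1) b, ∑ j ∈ Icc 0 T, W i * (x i j (i, j) + x i j (i + 1, j)) ^ 2 ≤
      ∑ i ∈ Icc (a - 1) b, W i * src i ^ 2 +
      ∑ i ∈ Icc (a - 1) b, ∑ j ∈ Icc 0 T, c * W i *
          (x i j (i, j + 1) + x i j (i + 1, j + 1)) ^ 2 := by
    rw [← sum_add_distrib]
    refine sum_le_sum fun i hi => ?_
    simp only [mem_Icc] at hi
    have h0 : (0 : ℤ) ∈ Icc 0 T := by simp [hT]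
    have : ∑ j ∈ Icc 0 T, (W i * (x i j (i, j) + x i j (i + 1, j)) ^ 2 -
        if j = 0 then W i * src i ^ 2 else 0) ≤
        ∑ j ∈ Icc 0 T, c * W i * (x i j (i, j + 1) + x i j (i + 1, j + 1)) ^ 2 := by
      refine sum_Icc_le_shift_left (fun j h1 h2 => ?_) ?_ fun j => ?_
      · rw [if_neg (by omega), sub_zero, hx.horSum i j hi.1 hi.2 (by omega) h2,
          show j - 1 + 1 = j by ring]
        have := mul_le_mul_of_nonneg_right (hWρ i)
          (sq_nonneg (t * (x i (j - 1) (i, j) + x i (j - 1) (i + 1, j))))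
        calc _ ≤ _ := this
          _ = _ := by ring
      · rw [hx.bottom i hi.1 hi.2]; simp
      · have := hW i; positivity
    rw [sum_sub_distrib, sum_ite_eq' (Icc 0 T) 0, if_pos h0] at this
    linarith
  have hface : ∑ i ∈ Icc (a - 1) b, ∑ j ∈ Icc 0 T,
      (c * W i * (x i j (i + 1, j + 1) + x i j (i + 1, j)) ^ 2 +
        c * W i * (x i j (i, j + 1) + x i j (i, j)) ^ 2 +
        c * W i * (x i j (i + 1, j) - x i j (i, j)) ^ 2 +
        c * W i * (x i j (i, j + 1) + x i j (i + 1, j + 1)) ^ 2) ≤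
      θ * ∑ i ∈ Icc (a - 1) b, ∑ j ∈ Icc 0 T, W i * faceDiff x i j := by
    simp only [mul_sum]
    refine sum_le_sum fun i _ => sum_le_sum fun j _ => ?_
    have h := antiperiodic_sum_le (x i j (i, j)) (x i j (i, j + 1)) (x i j (i + 1, j + 1))
        (x i j (i + 1, j))
    have h' := mul_le_mul_of_nonneg_left h (mul_nonneg hc (hW i))
    have h'' := mul_le_mul_of_nonneg_right hθ (mul_nonneg (hW i) (faceDiff_nonneg x i j))
    unfold faceDiff at h'' ⊢
    nlinarith
  have hsplit : ∑ i ∈ Icc (a - 1) b, ∑ j ∈ Icc 0 T, W i * faceDiff x i j =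
      ∑ i ∈ Icc (a - 1) b, ∑ j ∈ Icc 0 T, W i * (x i j (i, j + 1) - x i j (i, j)) ^ 2 +
      ∑ i ∈ Icc (a - 1) b, ∑ j ∈ Icc 0 T, W i * (x i j (i + 1, j + 1) - x i j (i, j + 1)) ^ 2 +
      ∑ i ∈ Icc (a - 1) b, ∑ j ∈ Icc 0 T, W i * (x i j (i + 1, j) - x i j (i + 1, j + 1)) ^ 2 +
      ∑ i ∈ Icc (a - 1) b, ∑ j ∈ Icc 0 T, W i * (x i j (i, j) + x i j (i + 1, j)) ^ 2 := by
    simp only [← sum_add_distrib, faceDiff, mul_add]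
  simp only [sum_add_distrib] at hface
  linarith

end Schonmann

namespace Schonmann

open Finset

noncomputable section

/-- The spin at `p` when the minus spins are exactly those in `S`. -/
def spn {α : Type*} [DecidableEq α] (S : Finset α) (p : α) : ℝ := if p ∈ S then -1 else 1

/-- The rectangle above the axis. -/
def rect (a b T : ℤ) : Finset (ℤ × ℤ) := Icc a b ×ˢ Icc 1 T

/-- Boundary values `η` on the axis, minus spins `S` elsewhere. -/
def glue (η : ℤ → ℝ) (S : Finset (ℤ × ℤ)) (p : ℤ × ℤ) : ℝ := if p.2 = 0 then η p.1 else spn S p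

/-- Interaction of a rectangle with its surroundings, with signs `κ` on horizontal edges. -/
def energy (a b T : ℤ) (κ ω : ℤ × ℤ → ℝ) : ℝ :=
  ∑ p ∈ Icc (a - 1) b ×ˢ Icc 1 T, κ p * (ω p * ω (p.1 + 1, p.2)) +
    ∑ p ∈ Icc a b ×ˢ Icc 0 T, ω p * ω (p.1, p.2 + 1)

/-- Partition function of the rectangle with boundary values `η` on the axis, plus elsewhere. -/
def Z (β : ℝ) (a b T : ℤ) (η : ℤ → ℝ) : ℝ :=
  ∑ S ∈ (rect a b T).powerset, Real.exp (β * energy a b T (fun _ => 1) (glue η S))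

/-- The step function changing sign between `i` and `i + 1`. -/
def step (i x : ℤ) : ℝ := if x ≤ i then -1 else 1

/-- The disorder line going from the axis up to the face `(i, j)`. -/
def line (i j : ℤ) (p : ℤ × ℤ) : ℝ := if p.1 = i ∧ p.2 ≤ j then -1 else 1

/-- The spin-disorder observable at the corner of the face `(i, j)` next to `v`. -/
def corner (β : ℝ) (a b T : ℤ) (η : ℤ → ℝ) (i j : ℤ) (v : ℤ × ℤ) : ℝ :=
  ∑ S ∈ (rect a b T).powerset, glue (fun x => η x * step i x) S v *
    Real.exp (β * energy a b T (line i j) (glue (fun x => η x * step i x) S))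

theorem spn_eq {α : Type*} [DecidableEq α] (S : Finset α) (p : α) : spn S p = 1 ∨ spn S p = -1 := by
  unfold spn; split_ifs <;> simp

theorem step_eq (i x : ℤ) : step i x = 1 ∨ step i x = -1 := by unfold step; split_ifs <;> simp

theorem glue_eq {η : ℤ → ℝ} (hη : ∀ x, η x = 1 ∨ η x = -1) (S : Finset (ℤ × ℤ)) (p : ℤ × ℤ) :
    glue η S p = 1 ∨ glue η S p = -1 := by
  unfold glue; split_ifs
  · exact hη _
  · exact spn_eq _ _

theorem mul_step_eq {η : ℤ → ℝ} (hη : ∀ x, η x = 1 ∨ η x = -1) (i x : ℤ) :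
    η x * step i x = 1 ∨ η x * step i x = -1 := by
  rcases hη x with h | h <;> rcases step_eq i x with h' | h' <;> simp [h, h']

theorem add_mul_exp {u v : ℝ} (hu : u = 1 ∨ u = -1) (hv : v = 1 ∨ v = -1) (β : ℝ) :
    (u + v) * Real.exp (-(2 * β) * (u * v)) = Real.exp (-(2 * β)) * (u + v) := by
  rcases hu with rfl | rfl <;> rcases hv with rfl | rfl <;> simp [mul_comm]

theorem sub_eq_mul_exp {u v : ℝ} (hu : u = 1 ∨ u = -1) (hv : v = 1 ∨ v = -1) (β : ℝ) :
    u - v = Real.exp (-(2 * β)) * ((u - v) * Real.exp (-(2 * β) * (u * v))) := by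
  have h : Real.exp (-(2 * β)) * Real.exp (2 * β) = 1 := by rw [← Real.exp_add]; simp
  rcases hu with rfl | rfl <;> rcases hv with rfl | rfl <;> simp
  · linear_combination -2 * h
  · linear_combination 2 * h

theorem energy_line_up (a b T : ℤ) {i j : ℤ} (h1 : a - 1 ≤ i) (h2 : i ≤ b) (h3 : 1 ≤ j) (h4 : j ≤ T)
    (ω : ℤ × ℤ → ℝ) :
    energy a b T (line i j) ω = energy a b T (line i (j - 1)) ω - 2 *
        (ω (i, j) * ω (i + 1, j)) := by
  have hm : (i, j) ∈ Icc (a - 1) b ×ˢ Icc 1 T := by simp; omega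
  unfold energy
  rw [← add_sum_erase _ _ hm, ← add_sum_erase _ (fun p => line i (j - 1) p *
      (ω p * ω (p.1 + 1, p.2))) hm]
  have : ∑ p ∈ (Icc (a - 1) b ×ˢ Icc 1 T).erase (i, j), line i j p * (ω p * ω (p.1 + 1, p.2)) =
      ∑ p ∈ (Icc (a - 1) b ×ˢ Icc 1 T).erase (i, j), line i (j - 1) p *
          (ω p * ω (p.1 + 1, p.2)) := by
    refine sum_congr rfl fun p hp => ?_
    have : p ≠ (i, j) := (mem_erase.1 hp).1
    have h : line i j p = line i (j - 1) p := by
      unfold line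
      have : ¬ (p.1 = i ∧ p.2 = j) := fun h => this (Prod.ext h.1 h.2)
      congr 1; apply propext; constructor <;> rintro ⟨e1, e2⟩ <;> exact ⟨e1, by omega⟩
    rw [h]
  rw [this]
  simp [line]
  ring

/-- The sign change caused by moving the disorder line one column to the right. -/
def colSign (i j : ℤ) (p : ℤ × ℤ) : ℝ := if p.1 = i ∧ 0 ≤ p.2 ∧ p.2 ≤ j then -1 else 1

theorem energy_line_right (a b T : ℤ) {i j : ℤ} (h1 : a ≤ i) (h2 : i ≤ b) (h3 : 0 ≤ j) (h4 : j ≤ T)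
    (ω : ℤ × ℤ → ℝ) :
    energy a b T (line i j) (fun p => ω p * colSign i j p) =
      energy a b T (line (i - 1) j) ω - 2 * (ω (i, j) * ω (i, j + 1)) := by
  have hm : (i, j) ∈ Icc a b ×ˢ Icc 0 T := by simp; omega
  unfold energy
  rw [← add_sum_erase (Icc a b ×ˢ Icc 0 T) _ hm,
    ← add_sum_erase (Icc a b ×ˢ Icc 0 T) (fun p => ω p * ω (p.1, p.2 + 1)) hm]
  have e1 : ∑ p ∈ Icc (a - 1) b ×ˢ Icc 1 T, line i j p * (ω p * colSign i j p *
        (ω (p.1 + 1, p.2) * colSign i j (p.1 + 1, p.2))) =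
      ∑ p ∈ Icc (a - 1) b ×ˢ Icc 1 T, line (i - 1) j p * (ω p * ω (p.1 + 1, p.2)) := by
    refine sum_congr rfl fun p hp => ?_
    simp only [mem_product, mem_Icc] at hp
    have : line i j p * colSign i j p * colSign i j (p.1 + 1, p.2) = line (i - 1) j p := by
      simp only [line, colSign]
      by_cases hj : p.2 ≤ j
      · by_cases c1 : p.1 = i
        · simp [c1, hj, show (0:ℤ) ≤ p.2 by omega, show i ≠ i - 1 by omega]
        · by_cases c2 : p.1 = i - 1
          · simp [c2, hj, show (0:ℤ) ≤ p.2 by omega]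
          · simp [c1, c2, show p.1 + 1 ≠ i by omega]
      · simp [hj]
    rw [← this]; ring
  have e2 : ∑ p ∈ (Icc a b ×ˢ Icc 0 T).erase (i, j), ω p * colSign i j p *
        (ω (p.1, p.2 + 1) * colSign i j (p.1, p.2 + 1)) =
      ∑ p ∈ (Icc a b ×ˢ Icc 0 T).erase (i, j), ω p * ω (p.1, p.2 + 1) := by
    refine sum_congr rfl fun p hp => ?_
    simp only [mem_erase, mem_product, mem_Icc] at hp
    have hne : ¬ (p.1 = i ∧ p.2 = j) := fun h => hp.1 (Prod.ext h.1 h.2)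
    have : colSign i j p * colSign i j (p.1, p.2 + 1) = 1 := by
      simp only [colSign]
      by_cases c : p.1 = i
      · by_cases c' : p.2 ≤ j
        · simp [c, c', show (0:ℤ) ≤ p.2 by omega, show (0:ℤ) ≤ p.2 + 1 by omega,
            show p.2 + 1 ≤ j by omega]
        · simp [c', show ¬ p.2 + 1 ≤ j by omega]
      · simp [c]
    linear_combination ω p * ω (p.1, p.2 + 1) * this
  rw [e1, e2]
  simp [colSign, h3]
  ring

theorem glue_symmDiff (η : ℤ → ℝ) (S : Finset (ℤ × ℤ)) {i j : ℤ} (hj : 0 ≤ j) :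
    glue (fun x => η x * step i x) (symmDiff S ({i} ×ˢ Icc 1 j)) =
      fun p => glue (fun x => η x * step (i - 1) x) S p * colSign i j p := by
  funext p
  by_cases hp : p.2 = 0
  · simp only [glue, hp, if_true, step, colSign]
    by_cases c : p.1 = i
    · simp [c, hj]
    · simp only [c, false_and, if_false, mul_one]
      congr 2
      apply propext; omega
  · simp only [glue, hp, if_false, spn, colSign, mem_symmDiff, mem_product, mem_singleton, mem_Icc]
    by_cases c : p.1 = i <;> by_cases c' : p ∈ S <;> by_cases c1 : 1 ≤ p.2 <;> by_cases c2 : p.2 ≤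
        j <;>
      simp [c, c', c1, c2, show (0 ≤ p.2) ↔ 1 ≤ p.2 by omega]

theorem sum_powerset_symmDiff {α : Type*} [DecidableEq α] {D C : Finset α} (hC : C ⊆ D)
    (f : Finset α → ℝ) : ∑ S ∈ D.powerset, f (symmDiff S C) = ∑ S ∈ D.powerset, f S := by
  have h : ∀ S ∈ D.powerset, symmDiff S C ∈ D.powerset := fun S hS => by
    rw [mem_powerset] at hS ⊢
    exact (symmDiff_le_sup (a := S) (b := C)).trans (union_subset hS hC)
  exact sum_bij' (fun S _ => symmDiff S C) (fun S _ => symmDiff S C) h h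
    (fun S _ => symmDiff_symmDiff_cancel_right C S) (fun S _ => symmDiff_symmDiff_cancel_right C S)
    fun _ _ => rfl

theorem corner_right (β : ℝ) {a b T : ℤ} (η : ℤ → ℝ) {i j : ℤ} (h1 : a ≤ i) (h2 : i ≤ b)
    (h3 : 0 ≤ j) (h4 : j ≤ T) (v : ℤ × ℤ) :
    corner β a b T η i j v = ∑ S ∈ (rect a b T).powerset, glue (fun x => η x * step (i - 1) x) S v *
      colSign i j v * (Real.exp (β * energy a b T (line (i - 1) j)
        (glue (fun x => η x * step (i - 1) x) S)) *
      Real.exp (-(2 * β) * (glue (fun x => η x * step (i - 1) x) S (i, j) *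
        glue (fun x => η x * step (i - 1) x) S (i, j + 1)))) := by
  have hC : ({i} ×ˢ Icc 1 j : Finset (ℤ × ℤ)) ⊆ rect a b T := fun p hp => by
    simp only [rect, mem_product, mem_singleton, mem_Icc] at hp ⊢; omega
  unfold corner
  rw [← sum_powerset_symmDiff hC]
  refine sum_congr rfl fun S _ => ?_
  rw [glue_symmDiff η S h3, energy_line_right a b T h1 h2 h3 h4, ← Real.exp_add]
  congr 2; ring

theorem corner_up (β : ℝ) {a b T : ℤ} (η : ℤ → ℝ) {i j : ℤ} (h1 : a - 1 ≤ i) (h2 : i ≤ b)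
    (h3 : 1 ≤ j) (h4 : j ≤ T) (v : ℤ × ℤ) :
    corner β a b T η i j v = ∑ S ∈ (rect a b T).powerset, glue (fun x => η x * step i x) S v *
      (Real.exp (β * energy a b T (line i (j - 1)) (glue (fun x => η x * step i x) S)) *
      Real.exp (-(2 * β) * (glue (fun x => η x * step i x) S (i, j) *
        glue (fun x => η x * step i x) S (i + 1, j)))) := by
  unfold corner
  refine sum_congr rfl fun S _ => ?_
  rw [energy_line_up a b T h1 h2 h3 h4, ← Real.exp_add]
  congr 2; ring

theorem energy_line_zero (a b T i : ℤ) (ω : ℤ × ℤ → ℝ) :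
    energy a b T (line i 0) ω = energy a b T (fun _ => 1) ω := by
  unfold energy
  congr 1
  refine sum_congr rfl fun p hp => ?_
  simp only [mem_product, mem_Icc] at hp
  rw [line, if_neg (by omega)]

theorem spn_of_not_mem_rect {a b T : ℤ} {S : Finset (ℤ × ℤ)} (hS : S ∈ (rect a b T).powerset)
    {p : ℤ × ℤ} (hp : p ∉ rect a b T) : spn S p = 1 :=
  if_neg fun h => hp (mem_powerset.1 hS h)

theorem corner_zero (β : ℝ) (a b T : ℤ) (η : ℤ → ℝ) (i x : ℤ) :
    corner β a b T η i 0 (x, 0) = η x * step i x * Z β a b T (fun x => η x * step i x) := by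
  simp [corner, Z, mul_sum, glue, energy_line_zero]

theorem isCornerSol_corner (β : ℝ) {a b T : ℤ} (hT : 0 ≤ T) {η : ℤ → ℝ}
    (hη : ∀ x, η x = 1 ∨ η x = -1) (hl : η (a - 1) = -1) (hr : η (b + 1) = 1) :
    IsCornerSol (Real.exp (-(2 * β))) a b T (corner β a b T η)
      fun i => (η (i + 1) - η i) * Z β a b T (fun x => η x * step i x) := by
  have hg : ∀ i S p, _ := fun i S p => glue_eq (mul_step_eq hη i) S p
  constructor
  · intro i j h1 h2 h3 h4
    rw [corner_up β η h1 h2 h3 h4, corner_up β η h1 h2 h3 h4]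
    simp only [corner]
    rw [← sum_add_distrib, ← sum_add_distrib, mul_sum]
    refine sum_congr rfl fun S _ => ?_
    linear_combination Real.exp (β * energy a b T (line i (j - 1))
        (glue (fun x => η x * step i x) S)) *
      add_mul_exp (hg i S (i, j)) (hg i S (i + 1, j)) β
  · intro i j h1 h2 h3 h4
    rw [corner_up β η h1 h2 h3 h4, corner_up β η h1 h2 h3 h4]
    simp only [corner]
    rw [← sum_sub_distrib, ← sum_sub_distrib, mul_sum]
    refine sum_congr rfl fun S _ => ?_
    linear_combination Real.exp (β * energy a b T (line i (j - 1))
        (glue (fun x => η x * step i x) S)) *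
      sub_eq_mul_exp (hg i S (i, j)) (hg i S (i + 1, j)) β
  · intro i j h1 h2 h3 h4
    rw [corner_right β η h1 h2 h3 h4, corner_right β η h1 h2 h3 h4]
    simp only [corner]
    rw [← sum_sub_distrib, ← sum_add_distrib, mul_sum]
    refine sum_congr rfl fun S _ => ?_
    rw [show colSign i j (i, j) = -1 by simp [colSign, h3],
        show colSign i j (i, j + 1) = 1 by simp [colSign]]
    linear_combination Real.exp (β * energy a b T (line (i - 1) j)
        (glue (fun x => η x * step (i - 1) x) S)) *
      add_mul_exp (hg (i - 1) S (i, j)) (hg (i - 1) S (i, j + 1)) β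
  · intro i j h1 h2 h3 h4
    rw [corner_right β η h1 h2 h3 h4, corner_right β η h1 h2 h3 h4]
    simp only [corner]
    rw [← sum_sub_distrib, ← sum_add_distrib, mul_sum]
    refine sum_congr rfl fun S _ => ?_
    rw [show colSign i j (i, j) = -1 by simp [colSign, h3],
        show colSign i j (i, j + 1) = 1 by simp [colSign]]
    linear_combination -Real.exp (β * energy a b T (line (i - 1) j)
        (glue (fun x => η x * step (i - 1) x) S)) *
      sub_eq_mul_exp (hg (i - 1) S (i, j)) (hg (i - 1) S (i, j + 1)) β
  · intro j h1 h2
    refine sum_congr rfl fun S hS => ?_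
    have e : ∀ y, 0 ≤ y → glue (fun x => η x * step (a - 1) x) S (a - 1, y) = 1 := fun y hy => by
      unfold glue
      split_ifs with h
      · simp [hl, step]
      · exact spn_of_not_mem_rect hS (by simp [rect])
    rw [e j h1, e (j + 1) (by omega)]
  · intro j h1 h2
    refine sum_congr rfl fun S hS => ?_
    have e : ∀ y, 0 ≤ y → glue (fun x => η x * step b x) S (b + 1, y) = 1 := fun y hy => by
      unfold glue
      split_ifs with h
      · simp [hr, step]
      · exact spn_of_not_mem_rect hS (by simp [rect])
    rw [e j h1, e (j + 1) (by omega)]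
  · intro i h1 h2
    refine sum_congr rfl fun S hS => ?_
    have e : ∀ x, glue (fun x => η x * step i x) S (x, T + 1) = 1 := fun x => by
      unfold glue
      rw [if_neg (by simp; omega)]
      exact spn_of_not_mem_rect hS (by simp [rect])
    rw [e, e]
  · intro i h1 h2
    rw [corner_zero, corner_zero]
    simp [step]
    ring

theorem Z_pos (β : ℝ) (a b T : ℤ) (η : ℤ → ℝ) : 0 < Z β a b T η :=
  sum_pos (fun _ _ => Real.exp_pos _) (powerset_nonempty _)

/-- The sites between the walls `i` and `k`. -/
def seg (i k : ℤ) : Finset ℤ := Ioc (min i k) (max i k)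

/-- The positions `k` such that exactly one of `k` and `k + 1` is in `A`. -/
def walls (A : Finset ℤ) : Finset ℤ := symmDiff A (A.image (· - 1))

theorem mem_walls {A : Finset ℤ} {k : ℤ} : k ∈ walls A ↔ ¬ (k ∈ A ↔ k + 1 ∈ A) := by
  have : k ∈ A.image (· - 1) ↔ k + 1 ∈ A := by
    rw [mem_image]
    exact ⟨by rintro ⟨x, hx, rfl⟩; simpa using hx, fun h => ⟨k + 1, h, by ring⟩⟩
  rw [walls, mem_symmDiff, this]; tauto

theorem walls_subset {a b : ℤ} {A : Finset ℤ} (hA : A ⊆ Icc a b) : walls A ⊆ Icc (a - 1) b := by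
  intro k hk
  rw [mem_walls] at hk
  have h1 : k ∈ A → k ∈ Icc a b := fun h => hA h
  have h2 : k + 1 ∈ A → k + 1 ∈ Icc a b := fun h => hA h
  simp only [mem_Icc] at *
  by_cases c : k ∈ A
  · have := h1 c; omega
  · have := h2 (by tauto); omega

theorem spn_symmDiff {α : Type*} [DecidableEq α] (A B : Finset α) (x : α) :
    spn (symmDiff A B) x = spn A x * spn B x := by
  unfold spn
  by_cases h : x ∈ A <;> by_cases h' : x ∈ B <;> simp [mem_symmDiff, h, h']

theorem spn_mul_self {α : Type*} [DecidableEq α] (A : Finset α) (x : α) : spn A x * spn A x =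
    1 := by
  rcases spn_eq A x with h | h <;> simp [h]

theorem spn_seg (i k x : ℤ) : spn (seg i k) x = step i x * step k x := by
  unfold spn seg step
  simp only [mem_Ioc]
  by_cases h : x ≤ i <;> by_cases h' : x ≤ k <;> simp [h, h']

theorem seg_comm (i k : ℤ) : seg i k = seg k i := by unfold seg; rw [min_comm, max_comm]

theorem corner_sq_le_faceDiff (x : ℤ → ℤ → ℤ × ℤ → ℝ) (i j : ℤ) :
    x i j (i, j) ^ 2 ≤ faceDiff x i j := by
  unfold faceDiff
  set p := x i j (i, j); set q := x i j (i, j + 1); set r := x i j (i + 1, j + 1)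
  set s := x i j (i + 1, j)
  nlinarith [sq_nonneg ((q - p) - (r - q)), sq_nonneg ((q - p) - (s - r)),
    sq_nonneg ((q - p) + (p + s)), sq_nonneg ((r - q) - (s - r)),
    sq_nonneg ((r - q) + (p + s)), sq_nonneg ((s - r) + (p + s))]

theorem isCornerSol_step (β : ℝ) {a b T q : ℤ} (hT : 0 ≤ T) (h1 : a - 1 ≤ q) (h2 : q ≤ b) :
    IsCornerSol (Real.exp (-(2 * β))) a b T (corner β a b T (step q))
      fun i => if i = q then 2 * Z β a b T (spn ∅) else 0 := by
  have h := isCornerSol_corner β (a := a) (b := b) hT (step_eq q) (by simp [step, h1])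
    (by simp [step]; omega)
  convert h using 2 with i
  split_ifs with c
  · subst c
    have : (fun x => step i x * step i x) = spn ∅ := by
      funext x; rcases step_eq i x with h | h <;> simp [h, spn]
    rw [this]; simp only [step, le_refl, if_true]; rw [if_neg (by omega)]; ring
  · have : step q (i + 1) - step q i = 0 := by
      unfold step
      by_cases c1 : i ≤ q
      · simp [c1, show i + 1 ≤ q by omega]
      · simp [c1, show ¬ i + 1 ≤ q by omega]
    rw [this, zero_mul]

theorem corner_step_sq (β : ℝ) (a b T q i : ℤ) :
    corner β a b T (step q) i 0 (i, 0) ^ 2 = Z β a b T (spn (seg q i)) ^ 2 := by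
  rw [corner_zero, mul_pow, ← spn_seg, pow_two (spn _ _), spn_mul_self, one_mul]
  congr 2; funext x; rw [spn_seg]

theorem tanh_bound {β : ℝ} (hβ : betaCrit < β) :
    Real.exp (-(2 * β)) ^ 2 * (3 + 2 * √2) < 1 := by
  have h2 : √2 ^ 2 = 2 := Real.sq_sqrt (by norm_num)
  have h0 : 0 ≤ √2 := Real.sqrt_nonneg 2
  have h : 1 + √2 < Real.exp (2 * β) := by
    rw [← Real.log_lt_iff_lt_exp (by positivity)]
    unfold betaCrit at hβ; linarith
  have h3 : Real.exp (-(2 * β)) * Real.exp (2 * β) = 1 := by rw [← Real.exp_add]; simp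
  have hp := Real.exp_pos (-(2 * β))
  have h4 : Real.exp (-(2 * β)) * (1 + √2) < 1 := by
    calc _ < Real.exp (-(2 * β)) * Real.exp (2 * β) := by gcongr
      _ = 1 := h3
  have h5 : 0 ≤ Real.exp (-(2 * β)) * (1 + √2) := by positivity
  have : Real.exp (-(2 * β)) ^ 2 * (3 + 2 * √2) = (Real.exp (-(2 * β)) * (1 + √2)) ^ 2 := by
    linear_combination (-Real.exp (-(2 * β)) ^ 2) * h2
  rw [this]; nlinarith

/-- Exponential decay, at rate `r`, of the partition functions with two walls. -/
structure DecayBound (β C r : ℝ) : Prop where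
  C_pos : 0 < C
  r_pos : 0 < r
  r_lt : r < 1
  le : ∀ a b T q i : ℤ, 0 ≤ T → a - 1 ≤ q → q ≤ b → a - 1 ≤ i → i ≤ b →
    Z β a b T (spn (seg q i)) ≤ C * r ^ (i - q).natAbs * Z β a b T (spn ∅)

/-- Exponential decay of the cost of flipping the boundary values between two walls. -/
theorem exists_decayBound {β : ℝ} (hβ : betaCrit < β) : ∃ C r : ℝ, DecayBound β C r := by
  set κ := Real.exp (-(2 * β)) ^ 2 * (3 + 2 * √2) with hκ
  have hκ1 : κ < 1 := tanh_bound hβ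
  have hκ0 : 0 < κ := by positivity
  set θ := (κ + 1) / 2
  set ρ := θ / κ with hρdef
  have hθ1 : θ < 1 := by simp only [θ]; linarith
  have hρ : 1 < ρ := by rw [hρdef, one_lt_div hκ0]; simp only [θ]; linarith
  have hρ0 : 0 < ρ := by linarith
  have hs : 1 < √ρ := by rw [Real.lt_sqrt (by norm_num)]; simpa using hρ
  refine ⟨√(4 / (1 - θ)), (√ρ)⁻¹, Real.sqrt_pos.2 (div_pos (by norm_num) (by linarith)),
    by positivity, inv_lt_one_of_one_lt₀ hs, fun a b T q i hT h1 h2 h3 h4 => ?_⟩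
  have hstep : ∀ n m : ℕ, n ≤ m + 1 → ρ ^ n ≤ ρ * ρ ^ m := fun n m h => by
    rw [← pow_succ']; exact pow_le_pow_right₀ hρ.le h
  have hE := (isCornerSol_step β hT h1 h2).energy_le (θ := θ) (ρ := ρ) hT hρ.le
    (by rw [hρdef]; apply le_of_eq; rw [mul_right_comm, ← hκ]; field_simp)
    (fun i => ρ ^ (i - q).natAbs) (fun i => by positivity)
    (fun i => hstep _ _ (by omega)) (fun i => hstep _ _ (by omega))
  have hZ := Z_pos β a b T (spn ∅)
  have hR : ∑ i ∈ Icc (a - 1) b, ρ ^ (i - q).natAbs *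
      (if i = q then 2 * Z β a b T (spn ∅) else 0) ^ 2 =
      4 * Z β a b T (spn ∅) ^ 2 := by
    rw [sum_eq_single q]
    · simp; ring
    · intro k _ hk; simp [hk]
    · intro h; simp at h; omega
  rw [hR] at hE
  have hterm : ∀ k l : ℤ, 0 ≤ ρ ^ (k - q).natAbs * faceDiff (corner β a b T (step q)) k l :=
    fun k l => mul_nonneg (by positivity) (faceDiff_nonneg _ _ _)
  have hle : ρ ^ (i - q).natAbs * Z β a b T (spn (seg q i)) ^ 2 ≤
      ∑ i ∈ Icc (a - 1) b, ∑ j ∈ Icc 0 T, ρ ^ (i - q).natAbs *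
          faceDiff (corner β a b T (step q)) i j := by
    have s1 := single_le_sum (f := fun j => ρ ^ (i - q).natAbs *
      faceDiff (corner β a b T (step q)) i j) (s := Icc 0 T) (fun j _ => hterm i j)
      (show (0 : ℤ) ∈ Icc 0 T by simp [hT])
    have s2 := single_le_sum (f := fun i => ∑ j ∈ Icc 0 T, ρ ^ (i - q).natAbs *
      faceDiff (corner β a b T (step q)) i j) (s := Icc (a - 1) b)
      (fun i _ => sum_nonneg fun j _ => hterm i j) (show i ∈ Icc (a - 1) b by simp [h3, h4])
    have s3 := corner_sq_le_faceDiff (corner β a b T (step q)) i 0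
    rw [corner_step_sq] at s3
    exact (mul_le_mul_of_nonneg_left s3 (by positivity)).trans (s1.trans s2)
  have hfin : ρ ^ (i - q).natAbs * Z β a b T (spn (seg q i)) ^ 2 ≤
      4 / (1 - θ) * Z β a b T (spn ∅) ^ 2 := by
    rw [div_mul_eq_mul_div, le_div_iff₀ (by linarith)]
    nlinarith [mul_le_mul_of_nonneg_left hle (show 0 ≤ 1 - θ by linarith)]
  refine le_of_sq_le_sq ?_ (by positivity)
  rw [mul_pow, mul_pow, Real.sq_sqrt (div_nonneg (by norm_num) (by linarith)), ← pow_mul,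
    mul_comm _ 2, pow_mul, inv_pow, Real.sq_sqrt hρ0.le, inv_pow]
  calc Z β a b T (spn (seg q i)) ^ 2
      = (ρ ^ (i - q).natAbs)⁻¹ * (ρ ^ (i - q).natAbs * Z β a b T (spn (seg q i)) ^ 2) := by
        rw [inv_mul_cancel_left₀ (by positivity)]
    _ ≤ (ρ ^ (i - q).natAbs)⁻¹ * (4 / (1 - θ) * Z β a b T (spn ∅) ^ 2) := by gcongr
    _ = _ := by ring

theorem IsCornerSol.eq_zero {t : ℝ} {a b T : ℤ} {x : ℤ → ℤ → ℤ × ℤ → ℝ} {src : ℤ → ℝ}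
    (hx : IsCornerSol t a b T x src) (hT : 0 ≤ T) (ht : t ^ 2 * (3 + 2 * √2) < 1)
    (hsrc : ∀ i ∈ Icc (a - 1) b, src i = 0) {i : ℤ} (hi : i ∈ Icc (a - 1) b) :
    x i 0 (i, 0) = 0 := by
  have hE := hx.energy_le hT le_rfl (θ := t ^ 2 * (3 + 2 * √2)) (by simp) (fun _ => 1)
    (fun _ => zero_le_one) (fun _ => by simp) (fun _ => by simp)
  rw [sum_eq_zero (s := Icc (a - 1) b) (f := fun i => 1 * src i ^ 2)
    fun i hi => by simp [hsrc i hi]] at hE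
  have s1 := single_le_sum (f := fun j => 1 * faceDiff x i j) (s := Icc 0 T)
    (fun j _ => by simpa using faceDiff_nonneg x i j) (show (0 : ℤ) ∈ Icc 0 T by simp [hT])
  have s2 := single_le_sum (f := fun i => ∑ j ∈ Icc 0 T, 1 * faceDiff x i j) (s := Icc (a - 1) b)
    (fun i _ => sum_nonneg fun j _ => by simpa using faceDiff_nonneg x i j) hi
  have s3 := corner_sq_le_faceDiff x i 0
  have s4 : x i 0 (i, 0) ^ 2 ≤ 0 := by
    simp only [one_mul] at *
    by_contra! hc
    nlinarith
  exact pow_eq_zero_iff two_ne_zero |>.1 (le_antisymm s4 (sq_nonneg _))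

/-- Expansion along a wall: the partition function with boundary set `A` is bounded by matching the
wall `i` with the other walls. -/
theorem wall_expansion {β : ℝ} (hβ : betaCrit < β) {a b T i : ℤ} (hT : 0 ≤ T) {A : Finset ℤ}
    (hA : A ⊆ Icc a b) (hi : i ∈ walls A) :
    Z β a b T (spn A) * Z β a b T (spn ∅) ≤ ∑ k ∈ (walls A).erase i,
      Z β a b T (spn (seg i k)) * Z β a b T (spn (symmDiff A (seg i k))) := by
  have hZ := Z_pos β a b T (spn ∅)
  have hiI : i ∈ Icc (a - 1) b := walls_subset hA hi
  set η : ℤ → ℝ := fun x => spn A x * step i x with hη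
  have hη1 : ∀ x, η x = 1 ∨ η x = -1 := mul_step_eq (spn_eq A) i
  have hl : η (a - 1) = -1 := by
    have h1 : a - 1 ∉ A := fun h => by have := hA h; simp at this
    simp only [mem_Icc] at hiI
    simp [hη, spn, h1, step, hiI.1]
  have hr : η (b + 1) = 1 := by
    have h1 : b + 1 ∉ A := fun h => by have := hA h; simp at this
    simp only [mem_Icc] at hiI
    simp [hη, spn, h1, step, show ¬ b + 1 ≤ i by omega]
  have hsol := isCornerSol_corner β hT hη1 hl hr
  have hw : ∀ k, η (k + 1) - η k ≠ 0 → k ∈ (walls A).erase i := by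
    intro k hk
    rw [mem_erase, mem_walls]
    constructor
    · rintro rfl
      rw [mem_walls] at hi
      apply hk
      simp only [hη, spn, step]
      by_cases c : k ∈ A <;> by_cases c' : k + 1 ∈ A <;> simp [c, c'] at hi ⊢
    · by_contra hc
      by_cases hki : k = i
      · subst hki; exact (mem_walls.1 hi) hc
      apply hk
      have : step i (k + 1) = step i k := by
        unfold step
        by_cases c1 : k ≤ i
        · simp [c1, show k + 1 ≤ i by omega]
        · simp [c1, show ¬ k + 1 ≤ i by omega]
      simp only [hη, this, spn, hc]; simp
  set src : ℤ → ℝ := fun k => (η (k + 1) - η k) * Z β a b T (fun x => η x * step k x) with hsrc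
  set c : ℤ → ℝ := fun k => src k / (2 * Z β a b T (spn ∅)) with hc
  have hsub := hsol.sub_sum ((walls A).erase i) c (fun k => corner β a b T (step k))
    (fun k i => if i = k then 2 * Z β a b T (spn ∅) else 0) fun k hk => by
      have := walls_subset hA (mem_of_mem_erase hk)
      simp only [mem_Icc] at this
      exact isCornerSol_step β hT this.1 this.2
  have hzero := hsub.eq_zero hT (tanh_bound hβ) (fun k _ => by
    by_cases hk : k ∈ (walls A).erase i
    · rw [sum_eq_single k]
      · simp only [if_true, hc, hsrc]; field_simp; ring
      · intro l _ hl; simp [hl.symm]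
      · exact fun h => absurd hk h
    · have h0 : η (k + 1) - η k = 0 := by by_contra h; exact hk (hw k h)
      rw [sum_eq_zero fun l hl => ?_]
      · simp [hsrc, h0]
      · have : k ≠ l := fun h => hk (h ▸ hl)
        simp [this]) hiI
  have hZA : |corner β a b T η i 0 (i, 0)| = Z β a b T (spn A) := by
    rw [corner_zero]
    have e : (fun x => η x * step i x) = spn A := by
      funext x; simp only [hη]
      rcases step_eq i x with h | h <;> simp [h]
    have e1 : η i * step i i = spn A i := congrFun e i
    rw [e, e1, abs_mul, abs_of_pos (Z_pos _ _ _ _ _)]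
    rcases spn_eq A i with h | h <;> simp [h]
  have hck : ∀ k, |c k| ≤ Z β a b T (spn (symmDiff A (seg i k))) / Z β a b T (spn ∅) := by
    intro k
    have e : (fun x => η x * step k x) = spn (symmDiff A (seg i k)) := by
      funext x; simp only [hη]; rw [spn_symmDiff, spn_seg]; ring
    have e2 : |η (k + 1) - η k| ≤ 2 := by
      rcases hη1 (k + 1) with h | h <;> rcases hη1 k with h' | h' <;> rw [h, h'] <;> norm_num
    simp only [hc, hsrc]
    rw [e, abs_div, abs_mul, abs_of_pos (Z_pos β a b T (spn (symmDiff A (seg i k)))),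
      abs_of_pos (show 0 < 2 * Z β a b T (spn ∅) by linarith)]
    rw [div_le_div_iff₀ (by linarith) hZ]
    have := Z_pos β a b T (spn (symmDiff A (seg i k)))
    nlinarith [mul_le_mul_of_nonneg_right e2 (mul_pos this hZ).le]
  have hyk : ∀ k, |corner β a b T (step k) i 0 (i, 0)| = Z β a b T (spn (seg i k)) := by
    intro k
    rw [← sq_eq_sq₀ (abs_nonneg _) (Z_pos _ _ _ _ _).le, sq_abs, corner_step_sq, seg_comm]
  rw [← hZA, sub_eq_zero.1 hzero]
  calc _ ≤ (∑ k ∈ (walls A).erase i, Z β a b T (spn (symmDiff A (seg i k))) / Z β a b T (spn ∅) *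
        Z β a b T (spn (seg i k))) * Z β a b T (spn ∅) := by
        refine mul_le_mul_of_nonneg_right ((abs_sum_le_sum_abs _ _).trans (sum_le_sum fun k _ =>
            ?_)) hZ.le
        rw [abs_mul, hyk]
        exact mul_le_mul_of_nonneg_right (hck k) (Z_pos _ _ _ _ _).le
    _ = _ := by
        rw [sum_mul]
        refine sum_congr rfl fun k _ => ?_
        field_simp

end

end Schonmann

namespace Schonmann

open Finset FinsetFamily

noncomputable section

theorem betaCrit_pos : 0 < betaCrit := by
  unfold betaCrit
  have : 0 < √2 := by positivity
  have := Real.log_pos (show 1 < 1 + √2 by linarith)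
  linarith

theorem mul_add_mul_le_lattice (u v u' v' : ℝ) :
    u * v + u' * v' ≤ max u u' * max v v' + min u u' * min v v' := by
  rcases le_total u u' with h | h <;> rcases le_total v v' with h' | h' <;> simp [h, h'] <;>
      nlinarith

theorem spn_inter {α : Type*} [DecidableEq α] (A B : Finset α) (x : α) :
    spn (A ∩ B) x = max (spn A x) (spn B x) := by
  unfold spn; by_cases h : x ∈ A <;> by_cases h' : x ∈ B <;> simp [h, h']

theorem spn_union {α : Type*} [DecidableEq α] (A B : Finset α) (x : α) :
    spn (A ∪ B) x = min (spn A x) (spn B x) := by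
  unfold spn; by_cases h : x ∈ A <;> by_cases h' : x ∈ B <;> simp [h, h']

theorem glue_inter (A B : Finset ℤ) (S S' : Finset (ℤ × ℤ)) (p : ℤ × ℤ) :
    glue (spn (A ∩ B)) (S ∩ S') p = max (glue (spn A) S p) (glue (spn B) S' p) := by
  unfold glue; split_ifs <;> simp [spn_inter]

theorem glue_union (A B : Finset ℤ) (S S' : Finset (ℤ × ℤ)) (p : ℤ × ℤ) :
    glue (spn (A ∪ B)) (S ∪ S') p = min (glue (spn A) S p) (glue (spn B) S' p) := by
  unfold glue; split_ifs <;> simp [spn_union]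

theorem energy_supermodular (a b T : ℤ) (A B : Finset ℤ) (S S' : Finset (ℤ × ℤ)) :
    energy a b T (fun _ => 1) (glue (spn A) S) + energy a b T (fun _ => 1) (glue (spn B) S') ≤
      energy a b T (fun _ => 1) (glue (spn (A ∩ B)) (S ∩ S')) +
        energy a b T (fun _ => 1) (glue (spn (A ∪ B)) (S ∪ S')) := by
  unfold energy
  have h : ∀ p q : ℤ × ℤ, _ := fun p q => mul_add_mul_le_lattice (glue (spn A) S p)
      (glue (spn A) S q)
    (glue (spn B) S' p) (glue (spn B) S' q)
  simp only [← glue_inter, ← glue_union] at h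
  have h1 := sum_le_sum fun p (_ : p ∈ Icc (a - 1) b ×ˢ Icc 1 T) => h p (p.1 + 1, p.2)
  have h2 := sum_le_sum fun p (_ : p ∈ Icc a b ×ˢ Icc 0 T) => h p (p.1, p.2 + 1)
  simp only [sum_add_distrib, one_mul] at *
  linarith

/-- Partition function of the spins in `D`, the other spins above the axis being plus. -/
def ZIn (β : ℝ) (D : Finset (ℤ × ℤ)) (a b T : ℤ) (η : ℤ → ℝ) : ℝ :=
  ∑ S ∈ D.powerset, Real.exp (β * energy a b T (fun _ => 1) (glue η S))

theorem ZIn_pos (β : ℝ) (D : Finset (ℤ × ℤ)) (a b T : ℤ) (η : ℤ → ℝ) : 0 < ZIn β D a b T η :=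
  sum_pos (fun _ _ => Real.exp_pos _) (powerset_nonempty _)

theorem ZIn_fkg {β : ℝ} (hβ : 0 ≤ β) {D D' : Finset (ℤ × ℤ)} (hD : D' ⊆ D) (a b T : ℤ)
    (A B : Finset ℤ) : ZIn β D' a b T (spn A) * ZIn β D a b T (spn B) ≤
      ZIn β D' a b T (spn (A ∩ B)) * ZIn β D a b T (spn (A ∪ B)) := by
  have hnn : ∀ η : ℤ → ℝ, (0 : Finset (ℤ × ℤ) → ℝ) ≤
      fun S => Real.exp (β * energy a b T (fun _ => 1) (glue η S)) := fun η S => (Real.exp_pos _).le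
  have h := Finset.four_functions_theorem D (𝒜 := D'.powerset) (ℬ := D.powerset)
    (hnn (spn A)) (hnn (spn B)) (hnn (spn (A ∩ B))) (hnn (spn (A ∪ B)))
    (fun S _ S' _ => by
      rw [← Real.exp_add, ← Real.exp_add, Real.exp_le_exp, ← mul_add, ← mul_add]
      exact mul_le_mul_of_nonneg_left (energy_supermodular a b T A B S S') hβ)
    (powerset_mono.2 hD) subset_rfl
  refine h.trans (mul_le_mul (sum_le_sum_of_subset_of_nonneg ?_ fun _ _ _ => (Real.exp_pos _).le)
    (sum_le_sum_of_subset_of_nonneg ?_ fun _ _ _ => (Real.exp_pos _).le)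
    (sum_nonneg fun _ _ => (Real.exp_pos _).le) (ZIn_pos _ _ _ _ _ _).le)
  · intro S hS
    obtain ⟨U, hU, V, -, rfl⟩ := mem_infs.1 hS
    exact mem_powerset.2 (inter_subset_left.trans (mem_powerset.1 hU))
  · intro S hS
    obtain ⟨U, hU, V, hV, rfl⟩ := mem_sups.1 hS
    exact mem_powerset.2 (union_subset ((mem_powerset.1 hU).trans hD) (mem_powerset.1 hV))

theorem Z_fkg {β : ℝ} (hβ : 0 ≤ β) (a b T : ℤ) (A B : Finset ℤ) :
    Z β a b T (spn A) * Z β a b T (spn B) ≤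
      Z β a b T (spn (A ∩ B)) * Z β a b T (spn (A ∪ B)) :=
  ZIn_fkg hβ subset_rfl a b T A B

/-- Enlarging the ambient rectangle only adds satisfied edges. -/
theorem energy_enlarge {a b a' b' T : ℤ} (ha : a' ≤ a) (hb : b ≤ b') :
    ∃ c : ℝ, ∀ A ⊆ Icc a b, ∀ S ⊆ rect a b T,
      energy a' b' T (fun _ => 1) (glue (spn A) S) =
        energy a b T (fun _ => 1) (glue (spn A) S) + c := by
  have e1 : Icc (a - 1) b ×ˢ Icc 1 T ⊆ Icc (a' - 1) b' ×ˢ Icc 1 T :=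
    product_subset_product_left (Icc_subset_Icc (by omega) hb)
  have e2 : Icc a b ×ˢ Icc 0 T ⊆ Icc a' b' ×ˢ Icc 0 T :=
    product_subset_product_left (Icc_subset_Icc ha hb)
  refine ⟨(((Icc (a' - 1) b' ×ˢ Icc 1 T) \ (Icc (a - 1) b ×ˢ Icc 1 T)).card : ℝ) +
    ((Icc a' b' ×ˢ Icc 0 T) \ (Icc a b ×ˢ Icc 0 T)).card, fun A hA S hS => ?_⟩
  have hout : ∀ p : ℤ × ℤ, p.1 ∉ Icc a b → glue (spn A) S p = 1 := fun p hp => by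
    unfold glue spn
    have h1 : p.1 ∉ A := fun h => hp (hA h)
    have h2 : p ∉ S := fun h => hp (mem_product.1 (hS h)).1
    simp [h1, h2]
  unfold energy
  rw [← sum_sdiff e1, ← sum_sdiff e2]
  have h1 : ∀ p ∈ (Icc (a' - 1) b' ×ˢ Icc 1 T) \ (Icc (a - 1) b ×ˢ Icc 1 T),
      1 * (glue (spn A) S p * glue (spn A) S (p.1 + 1, p.2)) = 1 := fun p hp => by
    simp only [Finset.mem_sdiff, mem_product, mem_Icc] at hp
    rw [hout p (by rw [mem_Icc]; omega), hout _ (by rw [mem_Icc]; dsimp only; omega), one_mul,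
        one_mul]
  have h2 : ∀ p ∈ (Icc a' b' ×ˢ Icc 0 T) \ (Icc a b ×ˢ Icc 0 T),
      glue (spn A) S p * glue (spn A) S (p.1, p.2 + 1) = 1 := fun p hp => by
    simp only [Finset.mem_sdiff, mem_product, mem_Icc] at hp
    rw [hout p (by rw [mem_Icc]; omega), hout _ (by rw [mem_Icc]; dsimp only; omega), one_mul]
  rw [sum_congr rfl h1, sum_congr rfl h2]
  simp only [sum_const, nsmul_eq_mul, mul_one]
  ring

theorem ZIn_rect_enlarge (β : ℝ) {a b a' b' T : ℤ} (ha : a' ≤ a) (hb : b ≤ b') :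
    ∃ c : ℝ, 0 < c ∧ ∀ A ⊆ Icc a b,
      ZIn β (rect a b T) a' b' T (spn A) = c * Z β a b T (spn A) := by
  obtain ⟨c, hc⟩ := energy_enlarge (T := T) ha hb
  refine ⟨Real.exp (β * c), Real.exp_pos _, fun A hA => ?_⟩
  unfold ZIn Z
  rw [mul_sum]
  refine sum_congr rfl fun S hS => ?_
  rw [hc A hA S (mem_powerset.1 hS), ← Real.exp_add]
  congr 1; ring

theorem Z_translate (β : ℝ) (a b T k : ℤ) (η : ℤ → ℝ) :
    Z β (a + k) (b + k) T (fun x => η (x - k)) = Z β a b T η := by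
  let e : ℤ × ℤ ≃ ℤ × ℤ := (Equiv.addRight k).prodCongr (Equiv.refl ℤ)
  have he : ∀ p : ℤ × ℤ, e p = (p.1 + k, p.2) := fun p => rfl
  have hI : ∀ a b c d : ℤ, Icc (a + k) (b + k) ×ˢ Icc c d =
      (Icc a b ×ˢ Icc c d).map e.toEmbedding := by
    intro a b c d
    ext p
    simp only [mem_map_equiv, mem_product, mem_Icc]
    have : e.symm p = (p.1 - k, p.2) := by rw [Equiv.symm_apply_eq, he]; simp
    rw [this]; dsimp only; omega
  symm
  refine sum_bij (fun S _ => S.map e.toEmbedding) ?_ ?_ ?_ ?_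
  · intro S hS
    rw [mem_powerset] at hS ⊢
    rw [rect, hI]
    exact map_subset_map.2 hS
  · intro S _ S' _ h
    exact map_injective _ h
  · intro S hS
    rw [mem_powerset, rect, hI] at hS
    obtain ⟨U, hU, rfl⟩ := subset_map_iff.1 hS
    exact ⟨U, mem_powerset.2 hU, rfl⟩
  · intro S _
    have hg : ∀ p, glue (fun x => η (x - k)) (S.map e.toEmbedding) (e p) = glue η S p := by
      intro p
      unfold glue spn
      rw [he]
      have : (p.1 + k, p.2) ∈ S.map e.toEmbedding ↔ p ∈ S := by
        rw [← he]; exact mem_map' e.toEmbedding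
      simp only [this, add_sub_cancel_right]
    have hg1 : ∀ p : ℤ × ℤ, glue (fun x => η (x - k)) (S.map e.toEmbedding) ((e p).1 + 1, (e p).2) =
        glue η S (p.1 + 1, p.2) := by
      intro p; rw [← hg, he, he]; congr 2; simp; ring
    have hg2 : ∀ p : ℤ × ℤ, glue (fun x => η (x - k)) (S.map e.toEmbedding) ((e p).1, (e p).2 + 1) =
        glue η S (p.1, p.2 + 1) := by
      intro p; rw [← hg, he, he]
    congr 2
    unfold energy
    rw [show a + k - 1 = a - 1 + k by ring, hI, hI, sum_map, sum_map]
    simp only [Equiv.coe_toEmbedding, hg, hg1, hg2]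

theorem Z_translate_Icc (β : ℝ) (a b T k c d : ℤ) :
    Z β (a + k) (b + k) T (spn (Icc (c + k) (d + k))) = Z β a b T (spn (Icc c d)) := by
  rw [← Z_translate β a b T k]
  congr 1; funext x
  unfold spn
  congr 1
  simp only [mem_Icc, eq_iff_iff]
  omega

/-- Crude bound for the price of changing boundary values in `g`. -/
theorem Z_le_of_eq_off {β : ℝ} (hβ : 0 ≤ β) (a b T : ℤ) {A B g : Finset ℤ}
    (hg : ∀ x, x ∉ g → (x ∈ A ↔ x ∈ B)) :
    Real.exp (-(2 * β) * g.card) * Z β a b T (spn A) ≤ Z β a b T (spn B) := by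
  unfold Z
  rw [mul_sum]
  refine sum_le_sum fun S _ => ?_
  rw [← Real.exp_add, Real.exp_le_exp]
  have : energy a b T (fun _ => 1) (glue (spn A) S) - energy a b T (fun _ => 1) (glue (spn B) S) ≤
      2 * g.card := by
    unfold energy
    have e1 : ∑ p ∈ Icc (a - 1) b ×ˢ Icc 1 T, (1 : ℝ) *
        (glue (spn A) S p * glue (spn A) S (p.1 + 1, p.2)) =
        ∑ p ∈ Icc (a - 1) b ×ˢ Icc 1 T, 1 * (glue (spn B) S p * glue (spn B) S (p.1 + 1, p.2)) := by
      refine sum_congr rfl fun p hp => ?_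
      simp only [mem_product, mem_Icc] at hp
      have : p.2 ≠ 0 := by omega
      simp [glue, this]
    rw [e1, add_sub_add_left_eq_sub, ← sum_sub_distrib]
    have e2 : ∀ p ∈ Icc a b ×ˢ Icc 0 T, glue (spn A) S p * glue (spn A) S (p.1, p.2 + 1) -
        glue (spn B) S p * glue (spn B) S (p.1, p.2 + 1) ≤
        if p.2 = 0 ∧ p.1 ∈ g then 2 else 0 := by
      intro p hp
      simp only [mem_product, mem_Icc] at hp
      have h1 : p.2 + 1 ≠ 0 := by omega
      by_cases h0 : p.2 = 0
      · by_cases hA : p.1 ∈ g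
        · rw [if_pos ⟨h0, hA⟩]
          simp only [glue, h0, if_true]
          rcases spn_eq A p.1 with h | h <;> rcases spn_eq B p.1 with h' | h' <;>
            rcases spn_eq S (p.1, 0 + 1) with h'' | h'' <;>
            rw [h, h'] <;> norm_num at h'' ⊢ <;> rw [h''] <;> norm_num
        · simp [glue, h0, hA, spn, hg p.1 hA]
      · simp [glue, h0, h1]
    refine (sum_le_sum e2).trans ?_
    rw [← sum_filter, sum_const, nsmul_eq_mul, mul_comm]
    gcongr
    calc _ ≤ (g ×ˢ ({0} : Finset ℤ)).card := card_le_card fun p hp => by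
            rw [mem_filter] at hp; exact mem_product.2 ⟨hp.2.2, mem_singleton.2 hp.2.1⟩
      _ = g.card := by simp
  nlinarith [mul_le_mul_of_nonneg_left this hβ]

theorem le_of_forall_pow_le {u r c : ℝ} (hr : 0 < r) (h : ∀ K : ℕ, u ^ K ≤ c * r ^ K) : u ≤ r := by
  by_contra! hlt
  have h1 : 1 < u / r := (one_lt_div hr).2 hlt
  obtain ⟨K, hK⟩ := pow_unbounded_of_one_lt c h1
  have := h K
  rw [div_pow, lt_div_iff₀ (by positivity)] at hK
  linarith

/-- Extending the block of minus boundary values starting at the left end by one site costs at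
least the decay rate. -/
theorem Z_ratio_le {β : ℝ} (hβ : 0 ≤ β) {C r : ℝ} (hdec : DecayBound β C r) {a b T q : ℤ}
    (hT : 0 ≤ T) (hq : a - 1 ≤ q) (hqb : q < b) :
    Z β a b T (spn (Icc a (q + 1))) ≤ r * Z β a b T (spn (Icc a q)) := by
  have hC := hdec.C_pos
  have hr := hdec.r_pos
  rw [← div_le_iff₀ (Z_pos _ _ _ _ _)]
  set u := Z β a b T (spn (Icc a (q + 1))) / Z β a b T (spn (Icc a q)) with hu
  have hu0 : 0 ≤ u := (div_pos (Z_pos _ _ _ _ _) (Z_pos _ _ _ _ _)).le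
  set m := Real.exp (-(2 * β) * (Icc a q).card)
  have hm : 0 < m := Real.exp_pos _
  refine le_of_forall_pow_le (c := C / m) hr fun K => ?_
  have hstep : ∀ k : ℕ, k < K → u * Z β a (b + K) T (spn (Icc a (q + k))) ≤
      Z β a (b + K) T (spn (Icc a (q + (k + 1 : ℕ)))) := by
    intro k hk
    have hsub : rect (a + k) (b + k) T ⊆ rect a (b + K) T :=
      product_subset_product_left (Icc_subset_Icc (by omega) (by omega))
    have h := ZIn_fkg hβ hsub a (b + K) T (Icc (a + k) (q + 1 + k)) (Icc a (q + k))
    obtain ⟨c, hc, hcZ⟩ := ZIn_rect_enlarge β (T := T) (a := a + k) (b := b + k) (a' := a)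
      (b' := b + K) (by omega) (by omega)
    have hi : Icc (a + k) (q + 1 + k) ∩ Icc a (q + k) = Icc (a + k) (q + k) := by
      ext x; simp; omega
    have hun : Icc (a + k) (q + 1 + k) ∪ Icc a (q + k) = Icc a (q + (k + 1 : ℕ)) := by
      ext x; simp; omega
    rw [hi, hun, hcZ _ (Icc_subset_Icc le_rfl (by omega)), hcZ _ (Icc_subset_Icc le_rfl (by omega)),
      Z_translate_Icc, Z_translate_Icc] at h
    change _ * Z β a (b + K) T _ ≤ _ * Z β a (b + K) T _ at h
    rw [hu, div_mul_eq_mul_div, div_le_iff₀ (Z_pos _ _ _ _ _)]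
    refine le_of_mul_le_mul_left ?_ hc
    linarith
  have hiter : ∀ k : ℕ, k ≤ K → u ^ k * Z β a (b + K) T (spn (Icc a q)) ≤
      Z β a (b + K) T (spn (Icc a (q + k))) := by
    intro k
    induction k with
    | zero => simp
    | succ k ih =>
      intro hk
      refine le_trans ?_ (hstep k hk)
      rw [pow_succ', mul_assoc]
      exact mul_le_mul_of_nonneg_left (ih (by omega)) hu0
  have h1 := hiter K le_rfl
  have h2 := hdec.le a (b + K) T (a - 1) (q + K) hT le_rfl (by omega) (by omega) (by omega)
  have hseg : seg (a - 1) (q + K) = Icc a (q + K) := by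
    unfold seg
    rw [min_eq_left (by omega), max_eq_right (by omega)]
    ext x; simp
  rw [hseg] at h2
  have h3 := Z_le_of_eq_off hβ a (b + K) T (A := ∅) (B := Icc a q) (g := Icc a q)
    fun x hx => by simp only [hx]; simp
  have h4 : r ^ (q + K - (a - 1)).natAbs ≤ r ^ K :=
      pow_le_pow_of_le_one hr.le hdec.r_lt.le (by omega)
  have hZ := Z_pos β a (b + K) T (spn ∅)
  rw [div_mul_eq_mul_div, le_div_iff₀ hm]
  refine le_of_mul_le_mul_right ?_ hZ
  calc u ^ K * m * Z β a (b + K) T (spn ∅) ≤ u ^ K * Z β a (b + K) T (spn (Icc a q)) := by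
        rw [mul_assoc]; exact mul_le_mul_of_nonneg_left h3 (by positivity)
    _ ≤ _ := h1
    _ ≤ _ := h2
    _ ≤ C * r ^ K * Z β a (b + K) T (spn ∅) := by gcongr

theorem walls_symmDiff (A B : Finset ℤ) : walls (symmDiff A B) = symmDiff (walls A) (walls B) := by
  ext k
  simp only [mem_walls, mem_symmDiff]
  tauto

theorem walls_seg (i k : ℤ) : walls (seg i k) = symmDiff {i} {k} := by
  ext x
  simp only [mem_walls, mem_symmDiff, mem_singleton, seg, mem_Ioc]
  omega

theorem symmDiff_seg_seg (i k l : ℤ) : symmDiff (seg i k) (seg i l) = seg k l := by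
  ext x
  simp only [mem_symmDiff, seg, mem_Ioc]
  omega

theorem card_walls_symmDiff_seg_le {A : Finset ℤ} {i k : ℤ} (hi : i ∈ walls A) (hk : k ∈ walls A) :
    (walls (symmDiff A (seg i k))).card ≤ (walls A).card := by
  refine card_le_card fun x hx => ?_
  rw [walls_symmDiff, walls_seg, mem_symmDiff, mem_symmDiff, mem_singleton, mem_singleton] at hx
  rcases hx with hx | ⟨hx, -⟩
  · exact hx.1
  · rcases hx with hx | hx
    · exact hx.1 ▸ hi
    · exact hx.1 ▸ hk

/-- The weight of the walls on the axis. -/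
def wallWeight (β : ℝ) (A : Finset ℤ) : ℝ := Real.exp (-(2 * β) * (walls A).card)

theorem wallWeight_pos (β : ℝ) (A : Finset ℤ) : 0 < wallWeight β A := Real.exp_pos _

theorem wallWeight_le {β : ℝ} (hβ : 0 ≤ β) {A B : Finset ℤ} (h : (walls B).card ≤ (walls A).card) :
    wallWeight β A ≤ wallWeight β B := by
  unfold wallWeight
  have : ((walls B).card : ℝ) ≤ (walls A).card := by exact_mod_cast h
  exact Real.exp_le_exp.2 (by nlinarith)

theorem add_sum_sq_le {ι : Type*} (P : Finset ι) {k G : ℝ} {c x : ι → ℝ}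
    (hc : ∀ p ∈ P, 0 ≤ c p) (hG : ∑ p ∈ P, c p ≤ G) :
    (k + ∑ p ∈ P, c p * x p) ^ 2 ≤ (1 + G) * (k ^ 2 + ∑ p ∈ P, c p * x p ^ 2) := by
  have h1 : (∑ p ∈ P, c p * x p) ^ 2 ≤ (∑ p ∈ P, c p) * ∑ p ∈ P, c p * x p ^ 2 :=
    sum_sq_le_sum_mul_sum_of_sq_le_mul P hc (fun p hp => mul_nonneg (hc p hp) (sq_nonneg _))
      fun p _ => le_of_eq (by ring)
  have h2 : 2 * k * ∑ p ∈ P, c p * x p ≤ (∑ p ∈ P, c p) * k ^ 2 + ∑ p ∈ P, c p * x p ^ 2 := by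
    rw [mul_sum, sum_mul, ← sum_add_distrib]
    refine sum_le_sum fun p hp => ?_
    nlinarith [mul_nonneg (hc p hp) (sq_nonneg (k - x p))]
  have h3 : 0 ≤ ∑ p ∈ P, c p * x p ^ 2 := sum_nonneg fun p hp => mul_nonneg (hc p hp) (sq_nonneg _)
  nlinarith [mul_le_mul_of_nonneg_right hG (add_nonneg (sq_nonneg k) h3)]

theorem seg_subset_Icc {c b q q' : ℤ} (hq : q ∈ Icc c b) (hq' : q' ∈ Icc c b) :
    seg q q' ⊆ Icc (c + 1) b := by
  intro x hx
  simp only [seg, mem_Ioc, mem_Icc] at *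
  omega

/-- Moving pairs of walls costs at most a factor `(1 + u * v) ^ 2` in a weighted `ℓ²` sum. -/
theorem sum_weight_mul_sq_le {c b : ℤ} {w k h : Finset ℤ → ℝ} {α γ : ℤ → ℝ} {u v : ℝ}
    (hw0 : ∀ A, 0 ≤ w A) (hh0 : ∀ A, 0 ≤ h A)
    (hα : ∀ q ∈ Icc c b, 0 ≤ α q) (hγ : ∀ q ∈ Icc c b, 0 ≤ γ q)
    (hu : ∑ q ∈ Icc c b, α q ≤ u) (hv : ∑ q ∈ Icc c b, γ q ≤ v)
    (hw : ∀ A, ∀ q ∈ walls A, ∀ q' ∈ walls A, w A ≤ w (symmDiff A (seg q q')))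
    (hh : ∀ A ⊆ Icc (c + 1) b, h A ≤ k A + ∑ q ∈ walls A, ∑ q' ∈ (walls A).erase q,
      α q * γ q' * k (symmDiff A (seg q q'))) :
    ∑ A ∈ (Icc (c + 1) b).powerset, w A * h A ^ 2 ≤
      (1 + u * v) ^ 2 * ∑ A ∈ (Icc (c + 1) b).powerset, w A * k A ^ 2 := by
  set Q := Icc c b
  have hc0 : ∀ p ∈ Q ×ˢ Q, 0 ≤ α p.1 * γ p.2 := fun p hp =>
    mul_nonneg (hα _ (mem_product.1 hp).1) (hγ _ (mem_product.1 hp).2)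
  have hG : ∑ p ∈ Q ×ˢ Q, α p.1 * γ p.2 ≤ u * v := by
    rw [sum_product, ← sum_mul_sum]
    exact mul_le_mul hu hv (sum_nonneg hγ) ((sum_nonneg hα).trans hu)
  have hG0 : 0 ≤ u * v := (sum_nonneg hc0).trans hG
  set S := ∑ A ∈ (Icc (c + 1) b).powerset, w A * k A ^ 2 with hS
  have key : ∀ A ∈ (Icc (c + 1) b).powerset, w A * h A ^ 2 ≤ (1 + u * v) * (w A * k A ^ 2 +
      ∑ p ∈ Q ×ˢ Q, α p.1 * γ p.2 *
        (w (symmDiff A (seg p.1 p.2)) * k (symmDiff A (seg p.1 p.2)) ^ 2)) := by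
    intro A hA
    have hA' := mem_powerset.1 hA
    have hWQ : walls A ⊆ Q := by simpa using walls_subset hA'
    set x : ℤ × ℤ → ℝ := fun p => if p.1 ∈ walls A ∧ p.2 ∈ (walls A).erase p.1 then
      k (symmDiff A (seg p.1 p.2)) else 0 with hx
    have h1 : h A ≤ k A + ∑ p ∈ Q ×ˢ Q, α p.1 * γ p.2 * x p := by
      refine (hh A hA').trans (add_le_add_right (le_of_eq ?_) _)
      rw [sum_product]
      rw [← sum_subset hWQ (fun q _ hq => sum_eq_zero fun q' _ => by simp [hx, hq])]
      refine sum_congr rfl fun q hq => ?_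
      rw [← sum_subset ((erase_subset _ _).trans hWQ)
          (fun q' _ hq' => by simp only [hx]; rw [if_neg (by tauto)]; ring)]
      refine sum_congr rfl fun q' hq' => ?_
      simp only [hx]; rw [if_pos ⟨hq, hq'⟩]
    have h2 := add_sum_sq_le (Q ×ˢ Q) (k := k A) (x := x) hc0 hG
    have h3 : h A ^ 2 ≤ (k A + ∑ p ∈ Q ×ˢ Q, α p.1 * γ p.2 * x p) ^ 2 :=
      pow_le_pow_left₀ (hh0 A) h1 2
    calc w A * h A ^ 2 ≤ w A * ((1 + u * v) * (k A ^ 2 + ∑ p ∈ Q ×ˢ Q, α p.1 * γ p.2 * x p ^ 2)) :=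
          mul_le_mul_of_nonneg_left (h3.trans h2) (hw0 A)
      _ = (1 + u * v) * (w A * k A ^ 2 + ∑ p ∈ Q ×ˢ Q, α p.1 * γ p.2 * (w A * x p ^ 2)) := by
          rw [mul_left_comm, mul_add, mul_sum]
          congr 2; exact sum_congr rfl fun p _ => by ring
      _ ≤ _ := by
          refine mul_le_mul_of_nonneg_left (add_le_add_right (sum_le_sum fun p hp =>
            mul_le_mul_of_nonneg_left ?_ (hc0 p hp)) _) (by linarith)
          simp only [hx]
          split_ifs with hp'
          · exact mul_le_mul_of_nonneg_right (hw A _ hp'.1 _ (mem_of_mem_erase hp'.2)) (sq_nonneg _)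
          · simpa using mul_nonneg (hw0 _) (sq_nonneg _)
  refine (sum_le_sum key).trans ?_
  rw [← mul_sum, sum_add_distrib, ← hS, sum_comm, sq, mul_assoc]
  refine mul_le_mul_of_nonneg_left ?_ (by linarith)
  have h4 : ∀ p ∈ Q ×ˢ Q, ∑ A ∈ (Icc (c + 1) b).powerset, α p.1 * γ p.2 *
      (w (symmDiff A (seg p.1 p.2)) * k (symmDiff A (seg p.1 p.2)) ^ 2) = α p.1 * γ p.2 * S := by
    intro p hp
    rw [← mul_sum, sum_powerset_symmDiff (seg_subset_Icc (mem_product.1 hp).1 (mem_product.1 hp).2)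
      fun A => w A * k A ^ 2]
  rw [sum_congr rfl h4, ← sum_mul, add_mul, one_mul]
  exact add_le_add_right (mul_le_mul_of_nonneg_right hG
    (sum_nonneg fun A _ => mul_nonneg (hw0 A) (sq_nonneg _))) _

theorem sum_pow_natAbs_le {r : ℝ} (h0 : 0 < r) (h1 : r < 1) (z b : ℤ) (l : ℕ) :
    ∑ q ∈ Icc (z + l) b, r ^ (q - z).natAbs ≤ r ^ l / (1 - r) := by
  have hsub : Icc (z + l) b ⊆ (range (b - z - l + 1).toNat).image fun n : ℕ => z + l + n := by
    intro q hq
    rw [mem_Icc] at hq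
    exact mem_image.2 ⟨(q - z - l).toNat, mem_range.2 (by omega), by omega⟩
  refine (sum_le_sum_of_subset_of_nonneg hsub fun _ _ _ => by positivity).trans ?_
  rw [sum_image (fun x _ y _ h => by simpa using h)]
  have : ∀ n ∈ range (b - z - l + 1).toNat, r ^ (z + l + (n : ℤ) - z).natAbs = r ^ l * r ^ n := by
    intro n _; rw [← pow_add]; congr 1; omega
  rw [sum_congr rfl this, ← mul_sum, div_eq_mul_inv]
  refine mul_le_mul_of_nonneg_left ?_ (by positivity)
  rw [← tsum_geometric_of_lt_one h0.le h1]
  exact (summable_geometric_of_lt_one h0.le h1).sum_le_tsum _ fun _ _ => by positivity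

theorem Z_Icc_le {β : ℝ} (hβ : 0 ≤ β) {C r : ℝ} (hdec : DecayBound β C r) {a b T z q : ℤ}
    (hT : 0 ≤ T) (hz : a - 1 ≤ z) (hzq : z ≤ q) (hqb : q ≤ b) :
    Z β a b T (spn (Icc a q)) ≤ r ^ (q - z).natAbs * Z β a b T (spn (Icc a z)) := by
  induction q, hzq using Int.leInduction with
  | base => simp
  | succ q hq ih =>
    refine (Z_ratio_le hβ hdec hT (by omega) (by omega)).trans ?_
    rw [show (q + 1 - z).natAbs = (q - z).natAbs + 1 by omega, pow_succ', mul_assoc]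
    exact mul_le_mul_of_nonneg_left (ih (by omega)) hdec.r_pos.le

theorem Icc_eq_seg {a z : ℤ} (h : a ≤ z + 1) : Icc a z = seg (a - 1) z := by
  ext x; simp only [seg, mem_Icc, mem_Ioc]; omega

/-- Comparison of the conditional partition functions of a distant set. -/
theorem Z_union_Icc_div_le {β : ℝ} (hβ : betaCrit < β) {C r : ℝ} (hdec : DecayBound β C r)
    {a b T z : ℤ} {l : ℕ} (hT : 0 ≤ T) (hz : a ≤ z) (hl : 1 ≤ l) {A : Finset ℤ}
    (hA : A ⊆ Icc (z + l + 1) b) :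
    Z β a b T (spn (Icc a z ∪ A)) / Z β a b T (spn (Icc a z)) ≤
      Z β a b T (spn A) / Z β a b T (spn ∅) +
        ∑ q ∈ walls A, ∑ q' ∈ (walls A).erase q, r ^ (q - z).natAbs * (C * r ^ (q' - z).natAbs) *
          (Z β a b T (spn (symmDiff A (seg q q'))) / Z β a b T (spn ∅)) := by
  have hβ0 : 0 ≤ β := (betaCrit_pos.trans hβ).le
  have hW : ∀ q ∈ walls A, z + l ≤ q ∧ q ≤ b := fun q hq => by
    have := walls_subset hA hq; rw [mem_Icc] at this; omega
  rcases A.eq_empty_or_nonempty with rfl | ⟨x0, hx0⟩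
  · have : walls ∅ = ∅ := by ext k; simp [mem_walls]
    rw [union_empty, this, sum_empty, div_self (Z_pos _ _ _ _ _).ne',
        div_self (Z_pos _ _ _ _ _).ne']
    simp
  have hx0' := mem_Icc.1 (hA hx0)
  have hLA : Icc a z ∪ A = symmDiff (seg (a - 1) z) A := by
    rw [← Icc_eq_seg (by omega)]
    ext x
    have : x ∈ A → x ∈ Icc (z + l + 1) b := fun h => hA h
    simp only [mem_union, mem_symmDiff, mem_Icc] at *
    by_cases h : x ∈ A
    · have := this h; grind
    · simp [h]
  have hLAsub : Icc a z ∪ A ⊆ Icc a b :=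
    union_subset (Icc_subset_Icc le_rfl (by omega)) (hA.trans (Icc_subset_Icc (by omega) le_rfl))
  have hwLA : walls (Icc a z ∪ A) = insert (a - 1) (insert z (walls A)) := by
    rw [hLA, walls_symmDiff, walls_seg]
    ext x
    have := hW x
    simp only [mem_symmDiff, mem_singleton, mem_insert]
    by_cases h : x ∈ walls A
    · have := this h; grind
    · grind
  have hzW : z ∉ walls A := fun h => by have := hW _ h; omega
  have haW : a - 1 ∉ insert z (walls A) := by
    rw [mem_insert]; rintro (h | h)
    · omega
    · have := hW _ h; omega
  set E := Z β a b T (spn ∅) with hE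
  have hE0 : 0 < E := Z_pos _ _ _ _ _
  set L := Z β a b T (spn (Icc a z)) with hL
  have hL0 : 0 < L := Z_pos _ _ _ _ _
  have h1 := wall_expansion hβ hT hLAsub (i := a - 1) (by rw [hwLA]; exact mem_insert_self _ _)
  rw [hwLA, erase_insert haW, sum_insert hzW, ← Icc_eq_seg (by omega), ← hE, ← hL] at h1
  have e1 : symmDiff (Icc a z ∪ A) (Icc a z) = A := by
    rw [hLA, ← Icc_eq_seg (by omega), symmDiff_comm, symmDiff_symmDiff_cancel_left]
  rw [e1] at h1
  have h2 : ∀ q ∈ walls A, Z β a b T (spn (seg (a - 1) q)) *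
      Z β a b T (spn (symmDiff (Icc a z ∪ A) (seg (a - 1) q))) ≤
      L * ∑ q' ∈ (walls A).erase q, r ^ (q - z).natAbs * (C * r ^ (q' - z).natAbs) *
          Z β a b T (spn (symmDiff A (seg q q'))) := by
    intro q hq
    have hq' := hW q hq
    have e2 : symmDiff (Icc a z ∪ A) (seg (a - 1) q) = symmDiff A (seg z q) := by
      rw [hLA, symmDiff_comm (seg (a - 1) z) A, symmDiff_assoc, symmDiff_seg_seg]
    have hwB : walls (symmDiff A (seg z q)) = insert z ((walls A).erase q) := by
      rw [walls_symmDiff, walls_seg]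
      ext x
      have := hW x
      simp only [mem_symmDiff, mem_singleton, mem_insert, mem_erase]
      by_cases h : x = z
      · grind
      · by_cases h' : x = q
        · grind
        · simp [h, h']
    have hBsub : symmDiff A (seg z q) ⊆ Icc a b := by
      intro x hx
      rw [mem_symmDiff] at hx
      rcases hx with hx | hx
      · have := hA hx.1; rw [mem_Icc] at *; omega
      · have := hx.1; simp only [seg, mem_Ioc, mem_Icc] at *; omega
    have h3 := wall_expansion hβ hT hBsub (i := z) (by rw [hwB]; exact mem_insert_self _ _)
    rw [hwB, erase_insert (fun h => hzW (mem_of_mem_erase h)), ← hE] at h3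
    rw [e2, ← Icc_eq_seg (by omega)]
    have h4 := Z_Icc_le hβ0 hdec (b := b) hT (by omega : a - 1 ≤ z) (by omega : z ≤ q) hq'.2
    rw [← hL] at h4
    have h5 : Z β a b T (spn (symmDiff A (seg z q))) ≤ ∑ q' ∈ (walls A).erase q,
        C * r ^ (q' - z).natAbs * Z β a b T (spn (symmDiff A (seg q q'))) := by
      refine le_of_mul_le_mul_right (h3.trans ?_) hE0
      rw [sum_mul]
      refine sum_le_sum fun q' hqe => ?_
      have hb := hW q' (mem_of_mem_erase hqe)
      rw [symmDiff_assoc, symmDiff_seg_seg, mul_right_comm]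
      exact mul_le_mul_of_nonneg_right (hdec.le a b T z q' hT (by omega) (by omega) (by omega)
        (by omega)) (Z_pos _ _ _ _ _).le
    refine (mul_le_mul h4 h5 (Z_pos _ _ _ _ _).le (mul_nonneg (pow_nonneg hdec.r_pos.le _) hL0.le)).trans
      (le_of_eq ?_)
    rw [mul_comm _ L, mul_assoc, mul_sum]
    congr 1
    exact sum_congr rfl fun q' _ => by ring
  have h6 := h1.trans (add_le_add_right (sum_le_sum h2) _)
  rw [← mul_sum, ← mul_add] at h6
  rw [div_le_iff₀ hL0]
  refine le_of_mul_le_mul_right (h6.trans (le_of_eq ?_)) hE0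
  simp_rw [← mul_div_assoc, ← sum_div]
  have : ∀ K S : ℝ, L * (K + S) = (K / E + S / E) * L * E := fun K S => by field_simp
  exact this _ _

/-- The weight of the axis configuration with minus spins at `A`. -/
def axisWeight (β : ℝ) (a b T : ℤ) (A : Finset ℤ) : ℝ :=
  wallWeight β A * Z β a b T (spn A) ^ 2

theorem axisWeight_pos (β : ℝ) (a b T : ℤ) (A : Finset ℤ) : 0 < axisWeight β a b T A :=
  mul_pos (wallWeight_pos _ _) (pow_pos (Z_pos _ _ _ _ _) 2)

theorem wallWeight_union (β : ℝ) {a b c z : ℤ} (h : z + 1 < c) {A B : Finset ℤ}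
    (hA : A ⊆ Icc a z) (hB : B ⊆ Icc c b) :
    wallWeight β (A ∪ B) = wallWeight β A * wallWeight β B := by
  have hd : Disjoint (walls A) (walls B) := by
    refine disjoint_left.2 fun x hx hx' => ?_
    have h1 := walls_subset hA hx
    have h2 := walls_subset hB hx'
    rw [mem_Icc] at h1 h2; omega
  have hu : walls (A ∪ B) = walls A ∪ walls B := by
    ext x
    have a1 : x ∈ A → x ∈ Icc a z := fun h => hA h
    have a2 : x + 1 ∈ A → x + 1 ∈ Icc a z := fun h => hA h
    have b1 : x ∈ B → x ∈ Icc c b := fun h => hB h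
    have b2 : x + 1 ∈ B → x + 1 ∈ Icc c b := fun h => hB h
    simp only [mem_walls, mem_union, mem_Icc] at *
    grind
  unfold wallWeight
  rw [hu, card_union_of_disjoint hd, ← Real.exp_add]
  push_cast; ring_nf

/-- The error made when forgetting the past across a gap of length `l`. -/
def gapError (C r : ℝ) (l : ℕ) : ℝ := (1 + r ^ l / (1 - r) * (C * (r ^ l / (1 - r)))) ^ 2 - 1

theorem sum_wallWeight_le {β : ℝ} (hβ : betaCrit < β) {C r : ℝ} (hdec : DecayBound β C r)
    {a b T z : ℤ} {l : ℕ} (hT : 0 ≤ T) (hz : a ≤ z) (hl : 1 ≤ l) :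
    ∑ A ∈ (Icc (z + l + 1) b).powerset, wallWeight β A *
        (Z β a b T (spn (Icc a z ∪ A)) / Z β a b T (spn (Icc a z))) ^ 2 ≤
      (1 + gapError C r l) * ∑ A ∈ (Icc (z + l + 1) b).powerset, wallWeight β A *
        (Z β a b T (spn A) / Z β a b T (spn ∅)) ^ 2 := by
  have hβ0 : 0 ≤ β := (betaCrit_pos.trans hβ).le
  have hr := hdec.r_pos.le
  have hC := hdec.C_pos.le
  have hs := sum_pow_natAbs_le hdec.r_pos hdec.r_lt z b l
  rw [gapError, add_sub_cancel]
  refine sum_weight_mul_sq_le (c := z + l) (α := fun q => r ^ (q - z).natAbs)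
    (γ := fun q => C * r ^ (q - z).natAbs)
    (w := wallWeight β) (k := fun A => Z β a b T (spn A) / Z β a b T (spn ∅))
    (h := fun A => Z β a b T (spn (Icc a z ∪ A)) / Z β a b T (spn (Icc a z)))
    (fun A => (wallWeight_pos β A).le) (fun A => (div_pos (Z_pos _ _ _ _ _) (Z_pos _ _ _ _ _)).le)
    (fun q _ => by positivity) (fun q _ => by positivity) hs ?_ ?_ ?_
  · rw [← mul_sum]; exact mul_le_mul_of_nonneg_left hs hC
  · exact fun A q hq q' hq' => wallWeight_le hβ0 (card_walls_symmDiff_seg_le hq hq')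
  · exact fun A hA => Z_union_Icc_div_le hβ hdec hT hz hl hA

theorem mixture_bounds {ε K Kf S Sf : ℝ} (hε : 0 ≤ ε) (hK : 0 < K) (hKf : 0 ≤ Kf)
    (hup : S ≤ (1 + ε) * K) (h1 : Kf ≤ Sf) (h2 : K - Kf ≤ S - Sf) (hle : Kf ≤ K) (hS : 0 ≤ S) :
    Kf / ((1 + ε) * K) * S ≤ Sf ∧ Sf ≤ (Kf / ((1 + ε) * K) + ε) * S := by
  have hd : 0 < (1 + ε) * K := by positivity
  set lo := Kf / ((1 + ε) * K) with hlo
  have hlo1 : lo * ((1 + ε) * K) = Kf := div_mul_cancel₀ _ hd.ne'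
  have hlo0 : 0 ≤ lo := div_nonneg hKf hd.le
  refine ⟨(mul_le_mul_of_nonneg_left hup hlo0).trans (by rw [hlo1]; exact h1), ?_⟩
  rcases le_total (lo + ε) 1 with h | h
  · have h3 := mul_le_mul_of_nonneg_left hup (sub_nonneg.2 h)
    have h4 := mul_nonneg (mul_nonneg hε hε) hK.le
    linarith
  · have h3 := mul_le_mul_of_nonneg_right h hS
    linarith

theorem gapError_nonneg {β C r : ℝ} (hdec : DecayBound β C r) (l : ℕ) : 0 ≤ gapError C r l := by
  have h : 0 ≤ r ^ l / (1 - r) := div_nonneg (pow_nonneg hdec.r_pos.le _) (by linarith [hdec.r_lt])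
  have := mul_nonneg h (mul_nonneg hdec.C_pos.le h)
  rw [gapError]; nlinarith

/-- The law of the far future given a gap of plus spins hardly depends on the past. -/
theorem gap_decoupling {β : ℝ} (hβ : betaCrit < β) {C r : ℝ} (hdec : DecayBound β C r)
    {a b T z : ℤ} {l : ℕ} (hT : 0 ≤ T) (hz : a ≤ z) (hl : 1 ≤ l) {f : Finset ℤ → ℝ}
    (h0 : ∀ A, 0 ≤ f A) (h1 : ∀ A, f A ≤ 1) :
    ∃ lo, ∀ A ⊆ Icc a z,
      lo * ∑ B ∈ (Icc (z + l + 1) b).powerset, axisWeight β a b T (A ∪ B) ≤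
        ∑ B ∈ (Icc (z + l + 1) b).powerset, f B * axisWeight β a b T (A ∪ B) ∧
      ∑ B ∈ (Icc (z + l + 1) b).powerset, f B * axisWeight β a b T (A ∪ B) ≤
        (lo + gapError C r l) *
          ∑ B ∈ (Icc (z + l + 1) b).powerset, axisWeight β a b T (A ∪ B) := by
  have hβ0 : 0 ≤ β := (betaCrit_pos.trans hβ).le
  set F := (Icc (z + l + 1) b).powerset
  set ε := gapError C r l
  have hε0 : 0 ≤ ε := gapError_nonneg hdec l
  set κ : Finset ℤ → ℝ := fun B => wallWeight β B * (Z β a b T (spn B) / Z β a b T (spn ∅)) ^ 2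
  have hκ : ∀ B, 0 < κ B := fun B =>
    mul_pos (wallWeight_pos _ _) (pow_pos (div_pos (Z_pos _ _ _ _ _) (Z_pos _ _ _ _ _)) 2)
  have hK0 : 0 < ∑ B ∈ F, κ B := sum_pos (fun B _ => hκ B) (powerset_nonempty _)
  refine ⟨(∑ B ∈ F, f B * κ B) / ((1 + ε) * ∑ B ∈ F, κ B), fun A hA => ?_⟩
  set g : Finset ℤ → ℝ := fun B =>
    wallWeight β B * (Z β a b T (spn (A ∪ B)) / Z β a b T (spn A)) ^ 2
  have hg0 : ∀ B, 0 ≤ g B := fun B => mul_nonneg (wallWeight_pos _ _).le (sq_nonneg _)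
  set m := axisWeight β a b T A
  have hm : 0 < m := axisWeight_pos _ _ _ _ _
  have hax : ∀ B ∈ F, axisWeight β a b T (A ∪ B) = m * g B := by
    intro B hB
    have := (Z_pos β a b T (spn A)).ne'
    simp only [m, g, axisWeight]
    rw [wallWeight_union β (by omega) hA (mem_powerset.1 hB)]
    field_simp
  have hlow : ∀ B ∈ F, κ B ≤ g B := by
    intro B hB
    have hd : A ∩ B = ∅ := by
      ext x
      have := mem_powerset.1 hB
      have h1 : x ∈ A → x ∈ Icc a z := fun h => hA h
      have h2 : x ∈ B → x ∈ Icc (z + l + 1) b := fun h => this h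
      rw [mem_Icc] at h1 h2
      simp only [mem_inter, notMem_empty, iff_false]
      rintro ⟨h, h'⟩; have := h1 h; have := h2 h'; omega
    have h := Z_fkg hβ0 a b T A B
    rw [hd] at h
    refine mul_le_mul_of_nonneg_left (pow_le_pow_left₀
      (div_pos (Z_pos _ _ _ _ _) (Z_pos _ _ _ _ _)).le ?_ 2) (wallWeight_pos _ _).le
    rw [div_le_div_iff₀ (Z_pos _ _ _ _ _) (Z_pos _ _ _ _ _)]
    linarith
  have hup : ∑ B ∈ F, g B ≤ (1 + ε) * ∑ B ∈ F, κ B := by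
    refine le_trans (sum_le_sum fun B hB => ?_) (sum_wallWeight_le hβ hdec hT hz hl)
    have h := Z_fkg hβ0 a b T (Icc a z) (A ∪ B)
    have e1 : Icc a z ∩ (A ∪ B) = A := by
      ext x
      have := mem_powerset.1 hB
      have h1 : x ∈ A → x ∈ Icc a z := fun h => hA h
      have h2 : x ∈ B → x ∈ Icc (z + l + 1) b := fun h => this h
      simp only [mem_Icc, mem_inter, mem_union] at *
      grind
    have e2 : Icc a z ∪ (A ∪ B) = Icc a z ∪ B := by
      rw [← union_assoc, union_eq_left.2 hA]
    rw [e1, e2] at h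
    refine mul_le_mul_of_nonneg_left (pow_le_pow_left₀
      (div_pos (Z_pos _ _ _ _ _) (Z_pos _ _ _ _ _)).le ?_ 2) (wallWeight_pos _ _).le
    rw [div_le_div_iff₀ (Z_pos _ _ _ _ _) (Z_pos _ _ _ _ _)]
    linarith
  have hS : ∑ B ∈ F, axisWeight β a b T (A ∪ B) = m * ∑ B ∈ F, g B := by
    rw [mul_sum]; exact sum_congr rfl hax
  have hSf : ∑ B ∈ F, f B * axisWeight β a b T (A ∪ B) = m * ∑ B ∈ F, f B * g B := by
    rw [mul_sum]; exact sum_congr rfl fun B hB => by rw [hax B hB]; ring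
  have hl1 : ∑ B ∈ F, f B * κ B ≤ ∑ B ∈ F, f B * g B :=
    sum_le_sum fun B hB => mul_le_mul_of_nonneg_left (hlow B hB) (h0 B)
  have hl2 : ∑ B ∈ F, (1 - f B) * κ B ≤ ∑ B ∈ F, (1 - f B) * g B :=
    sum_le_sum fun B hB => mul_le_mul_of_nonneg_left (hlow B hB) (by linarith [h1 B])
  simp only [sub_mul, one_mul, sum_sub_distrib] at hl2
  rw [hS, hSf]
  set K := ∑ B ∈ F, κ B
  set Kf := ∑ B ∈ F, f B * κ B
  set S := ∑ B ∈ F, g B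
  set Sf := ∑ B ∈ F, f B * g B
  have hKf0 : 0 ≤ Kf := sum_nonneg fun B _ => mul_nonneg (h0 B) (hκ B).le
  have hKfK : Kf ≤ K := sum_le_sum fun B _ => by
    have := h1 B; have := hκ B; nlinarith
  obtain ⟨c1, c2⟩ := mixture_bounds hε0 hK0 (S := S) (Sf := Sf) hKf0 hup hl1 hl2 hKfK
    (sum_nonneg fun B _ => hg0 B)
  constructor
  · calc _ = m * (_ * S) := by ring
      _ ≤ _ := mul_le_mul_of_nonneg_left c1 hm.le
  · calc m * Sf ≤ m * (_ * S) := mul_le_mul_of_nonneg_left c2 hm.le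
      _ = _ := by ring

theorem sum_powerset_union {α M : Type*} [DecidableEq α] [AddCommMonoid M] {U V : Finset α}
    (h : Disjoint U V) (F : Finset α → M) :
    ∑ B ∈ (U ∪ V).powerset, F B = ∑ X ∈ U.powerset, ∑ Y ∈ V.powerset, F (X ∪ Y) := by
  rw [← sum_product']
  refine sum_nbij' (fun B => (B ∩ U, B ∩ V)) (fun p => p.1 ∪ p.2) ?_ ?_ ?_ ?_ ?_
  · intro B _; simp
  · intro p hp
    rw [mem_product, mem_powerset, mem_powerset] at hp
    exact mem_powerset.2 (union_subset_union hp.1 hp.2)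
  · intro B hB
    rw [← inter_union_distrib_left, inter_eq_left.2 (mem_powerset.1 hB)]
  · intro p hp
    rw [mem_product, mem_powerset, mem_powerset] at hp
    have h1 : p.2 ∩ U = ∅ := disjoint_iff_inter_eq_empty.1 ((h.mono_right hp.2).symm)
    have h2 : p.1 ∩ V = ∅ := disjoint_iff_inter_eq_empty.1 (h.mono_left hp.1)
    ext1
    · simp only [union_inter_distrib_right, h1, union_empty, inter_eq_left.2 hp.1]
    · simp only [union_inter_distrib_right, h2, empty_union, inter_eq_left.2 hp.2]
  · intro B hB
    simp only
    rw [← inter_union_distrib_left, inter_eq_left.2 (mem_powerset.1 hB)]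

theorem sum_powerset_Icc {M : Type*} [AddCommMonoid M] {x y w : ℤ} (h1 : x ≤ y + 1) (h2 : y ≤ w)
    (F : Finset ℤ → M) :
    ∑ B ∈ (Icc x w).powerset, F B =
      ∑ X ∈ (Icc x y).powerset, ∑ Y ∈ (Icc (y + 1) w).powerset, F (X ∪ Y) := by
  rw [← sum_powerset_union]
  · congr 2; ext u; simp only [mem_Icc, mem_union]; omega
  · exact disjoint_left.2 fun u => by simp only [mem_Icc]; omega

theorem card_walls_le_of_eq_off {A B g : Finset ℤ} (hg : ∀ x ∉ g, (x ∈ A ↔ x ∈ B)) :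
    (walls B).card ≤ (walls A).card + 2 * g.card := by
  have h : walls B ⊆ walls A ∪ (g ∪ g.image (· - 1)) := by
    intro x hx
    rw [mem_walls] at hx
    simp only [mem_union, mem_walls, mem_image]
    by_contra! hc
    have h1 := hg x hc.2.1
    have h2 := hg (x + 1) fun h => hc.2.2 _ h (by ring)
    tauto
  have := (card_le_card h).trans (card_union_le _ _)
  have := card_union_le g (g.image (· - 1))
  have := card_image_le (s := g) (f := (· - 1))
  omega

theorem axisWeight_le_of_eq_off {β : ℝ} (hβ : 0 ≤ β) (a b T : ℤ) {A B g : Finset ℤ}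
    (hg : ∀ x ∉ g, (x ∈ A ↔ x ∈ B)) :
    Real.exp (-(8 * β) * g.card) * axisWeight β a b T A ≤ axisWeight β a b T B := by
  have h1 := Z_le_of_eq_off hβ a b T hg
  have h2 : Real.exp (-(4 * β) * g.card) * wallWeight β A ≤ wallWeight β B := by
    unfold wallWeight
    rw [← Real.exp_add]
    have : ((walls B).card : ℝ) ≤ (walls A).card + 2 * g.card := by
      exact_mod_cast card_walls_le_of_eq_off hg
    exact Real.exp_le_exp.2 (by nlinarith)
  have h3 : Real.exp (-(8 * β) * g.card) =
      Real.exp (-(4 * β) * g.card) * Real.exp (-(2 * β) * g.card) ^ 2 := by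
    rw [← Real.exp_nat_mul, ← Real.exp_add]; congr 1; push_cast; ring
  have hp := Z_pos β a b T (spn A)
  unfold axisWeight
  calc _ = (Real.exp (-(4 * β) * g.card) * wallWeight β A) *
        (Real.exp (-(2 * β) * g.card) * Z β a b T (spn A)) ^ 2 := by rw [h3]; ring
    _ ≤ _ := mul_le_mul h2 (pow_le_pow_left₀ (by positivity) h1 2) (by positivity)
        (wallWeight_pos _ _).le

/-- The total weight of an observable over all continuations of `A` beyond `z`. -/
def futureSum (β : ℝ) (a b T : ℤ) (f : Finset ℤ → ℝ) (z : ℤ) (A : Finset ℤ) : ℝ :=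
  ∑ B ∈ (Icc (z + 1) b).powerset, f (A ∪ B) * axisWeight β a b T (A ∪ B)

theorem futureSum_eq_sum (β : ℝ) (a T : ℤ) {b z : ℤ} {l : ℕ} (h : z + l ≤ b) (f : Finset ℤ → ℝ)
    (A : Finset ℤ) :
    futureSum β a b T f z A =
      ∑ X ∈ (Icc (z + 1) (z + l)).powerset, futureSum β a b T f (z + l) (A ∪ X) := by
  unfold futureSum
  rw [sum_powerset_Icc (y := z + l) (by omega) h]
  simp only [union_assoc]

/-- A lower bound for the conditional probability of a block of `l` plus spins. -/
def blockProb (β : ℝ) (l : ℕ) : ℝ := Real.exp (-(8 * β) * l) / 2 ^ l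

theorem blockProb_pos (β : ℝ) (l : ℕ) : 0 < blockProb β l := by unfold blockProb; positivity

theorem blockProb_mul_futureSum_le {β : ℝ} (hβ : 0 ≤ β) (a T : ℤ) {b z : ℤ} {l : ℕ}
    (h : z + l ≤ b) (A : Finset ℤ) :
    blockProb β l * futureSum β a b T (fun _ => 1) z A ≤
      futureSum β a b T (fun _ => 1) (z + l) A := by
  rw [futureSum_eq_sum β a T h, blockProb, div_mul_eq_mul_div, div_le_iff₀ (by positivity)]
  have hcard : (Icc (z + 1) (z + l)).card = l := by rw [Int.card_Icc]; omega
  have : ∀ X ∈ (Icc (z + 1) (z + l)).powerset,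
      Real.exp (-(8 * β) * l) * futureSum β a b T (fun _ => 1) (z + l) (A ∪ X) ≤
        futureSum β a b T (fun _ => 1) (z + l) A := by
    intro X hX
    unfold futureSum
    rw [mul_sum]
    refine sum_le_sum fun B _ => ?_
    rw [one_mul, one_mul, ← hcard]
    refine axisWeight_le_of_eq_off hβ a b T fun x hx => ?_
    have : x ∉ X := fun h => hx (mem_powerset.1 hX h)
    simp [this]
  rw [mul_sum]
  refine (sum_le_sum this).trans (le_of_eq ?_)
  rw [sum_const, card_powerset, hcard, nsmul_eq_mul]
  push_cast; ring

theorem futureSum_one_nonneg (β : ℝ) (a b T z : ℤ) (A : Finset ℤ) :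
    0 ≤ futureSum β a b T (fun _ => 1) z A :=
  sum_nonneg fun B _ => by rw [one_mul]; exact (axisWeight_pos _ _ _ _ _).le

theorem regeneration_step {c ε D x M S Mf R lo lo' : ℝ} (hc0 : 0 ≤ c) (hM : 0 ≤ M)
    (hS : c * M ≤ S) (hx : Mf = x + R)
    (h1 : lo * S ≤ x) (h2 : x ≤ (lo + ε) * S) (h1' : lo' * S ≤ x) (h2' : x ≤ (lo' + D) * S)
    (h3 : lo' * (M - S) ≤ R) (h4 : R ≤ (lo' + D) * (M - S)) (hS0 : 0 < S) :
    (c * lo + (1 - c) * lo') * M ≤ Mf ∧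
      Mf ≤ (c * lo + (1 - c) * lo' + (c * ε + (1 - c) * D)) * M := by
  obtain ⟨p, hp⟩ : ∃ p, x = p * S := ⟨x / S, by field_simp⟩
  rw [hp] at h1 h2 h1' h2'
  have a1 : lo ≤ p := le_of_mul_le_mul_right h1 hS0
  have a2 : p ≤ lo + ε := le_of_mul_le_mul_right h2 hS0
  have a3 : lo' ≤ p := le_of_mul_le_mul_right h1' hS0
  have a4 : p ≤ lo' + D := le_of_mul_le_mul_right h2' hS0
  have b1 : 0 ≤ S - c * M := by linarith
  have b2 : 0 ≤ c * M := mul_nonneg hc0 hM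
  have := mul_le_mul_of_nonneg_right a1 b2
  have := mul_le_mul_of_nonneg_right a2 b2
  have := mul_le_mul_of_nonneg_right a3 b1
  have := mul_le_mul_of_nonneg_right a4 b1
  constructor <;> rw [hx, hp] <;> linarith

/-- Each gap of plus spins is an opportunity to forget the past. -/
theorem regeneration {β : ℝ} (hβ : betaCrit < β) {C r : ℝ} (hdec : DecayBound β C r)
    {a b T n : ℤ} {l : ℕ} (hT : 0 ≤ T) (hl : 1 ≤ l) {f : Finset ℤ → ℝ}
    (h0 : ∀ A, 0 ≤ f A) (h1 : ∀ A, f A ≤ 1)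
    (hf : ∀ A B : Finset ℤ, (∀ x, n ≤ x → (x ∈ A ↔ x ∈ B)) → f A = f B) (hn : n ≤ b) (k : ℕ) :
    ∀ z : ℤ, a ≤ z → z + k * l < n → ∃ lo, ∀ A ⊆ Icc a z,
      lo * futureSum β a b T (fun _ => 1) z A ≤ futureSum β a b T f z A ∧
      futureSum β a b T f z A ≤ (lo + (gapError C r l + (1 - blockProb β l) ^ k)) *
        futureSum β a b T (fun _ => 1) z A := by
  have hβ0 : 0 ≤ β := (betaCrit_pos.trans hβ).le
  induction k with
  | zero =>
    refine fun z _ _ => ⟨0, fun A _ => ⟨?_, ?_⟩⟩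
    · rw [zero_mul]
      exact sum_nonneg fun B _ => mul_nonneg (h0 _) (axisWeight_pos _ _ _ _ _).le
    · have h2 : futureSum β a b T f z A ≤ futureSum β a b T (fun _ => 1) z A :=
        sum_le_sum fun B _ => mul_le_mul_of_nonneg_right (h1 _) (axisWeight_pos _ _ _ _ _).le
      have := mul_nonneg (gapError_nonneg hdec l) (futureSum_one_nonneg β a b T z A)
      rw [pow_zero]; linarith
  | succ k ih =>
    intro z hz hzk
    push_cast at hzk
    have hkl : (0 : ℤ) ≤ k * l := by positivity
    have hlb : z + l ≤ b := by nlinarith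
    obtain ⟨lo, hlo⟩ := gap_decoupling hβ hdec (b := b) hT hz hl h0 h1
    obtain ⟨lo', hlo'⟩ := ih (z + l) (by omega) (by linarith)
    refine ⟨blockProb β l * lo + (1 - blockProb β l) * lo', fun A hA => ?_⟩
    have hgap := hlo A hA
    have e1 : ∑ B ∈ (Icc (z + l + 1) b).powerset, axisWeight β a b T (A ∪ B) =
        futureSum β a b T (fun _ => 1) (z + l) A := by simp [futureSum]
    have e2 : ∑ B ∈ (Icc (z + l + 1) b).powerset, f B * axisWeight β a b T (A ∪ B) =
        futureSum β a b T f (z + l) A := by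
      refine sum_congr rfl fun B _ => ?_
      rw [hf B (A ∪ B) fun x hx => ?_]
      have : x ∉ A := fun h => by
        have := mem_Icc.1 (hA h)
        nlinarith
      simp [this]
    rw [e1, e2] at hgap
    have hsplit : ∀ g : Finset ℤ → ℝ, futureSum β a b T g z A = futureSum β a b T g (z + l) A +
        ∑ X ∈ (Icc (z + 1) (z + l)).powerset.erase ∅, futureSum β a b T g (z + l) (A ∪ X) := by
      intro g
      rw [futureSum_eq_sum β a T hlb, ← add_sum_erase _ _ (empty_mem_powerset _), union_empty]
    have hsub : ∀ X ∈ (Icc (z + 1) (z + l)).powerset, A ∪ X ⊆ Icc a (z + l) := fun X hX =>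
      union_subset (hA.trans (Icc_subset_Icc le_rfl (by omega)))
        ((mem_powerset.1 hX).trans (Icc_subset_Icc (by omega) le_rfl))
    have hA' := hlo' A (by simpa using hsub ∅ (empty_mem_powerset _))
    have hR := hsplit fun _ => 1
    have := regeneration_step (blockProb_pos β l).le (futureSum_one_nonneg β a b T z A)
      (blockProb_mul_futureSum_le hβ0 a T hlb A) (hsplit f) hgap.1 hgap.2 hA'.1 hA'.2
      (by
        rw [hR, add_sub_cancel_left, mul_sum]
        exact sum_le_sum fun X hX => (hlo' _ (hsub X (mem_of_mem_erase hX))).1)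
      (by
        rw [hR, add_sub_cancel_left, mul_sum]
        exact sum_le_sum fun X hX => (hlo' _ (hsub X (mem_of_mem_erase hX))).2)
      (sum_pos (fun B _ => by rw [one_mul]; exact axisWeight_pos _ _ _ _ _) (powerset_nonempty _))
    convert this using 4
    ring

theorem exists_gapError_le {β C r : ℝ} (hdec : DecayBound β C r) {δ : ℝ} (hδ : 0 < δ) :
    ∃ l : ℕ, 1 ≤ l ∧ gapError C r l ≤ δ := by
  have h0 : Tendsto (fun l : ℕ => r ^ l) atTop (𝓝 0) :=
    tendsto_pow_atTop_nhds_zero_of_lt_one hdec.r_pos.le hdec.r_lt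
  have h : Tendsto (fun l => gapError C r l) atTop (𝓝 0) := by
    have h1 := h0.div_const (1 - r)
    have := (((h1.mul (h1.const_mul C)).const_add 1).pow 2).sub_const 1
    simpa [gapError] using this
  obtain ⟨l, h1, h2⟩ := ((eventually_ge_atTop 1).and (h.eventually (ge_mem_nhds hδ))).exists
  exact ⟨l, h1, h2⟩

/-- Uniform `φ`-mixing of the axis marginal of finite boxes. -/
theorem exists_axisWeight_mixing {β : ℝ} (hβ : betaCrit < β) {δ : ℝ} (hδ : 0 < δ) :
    ∃ N : ℕ, ∀ n : ℤ, N ≤ n → ∀ a b T : ℤ, 0 ≤ T → a ≤ -1 → n ≤ b → ∀ e f : Finset ℤ → ℝ,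
      (∀ A, 0 ≤ e A) → (∀ A B : Finset ℤ, (∀ x < 0, (x ∈ A ↔ x ∈ B)) → e A = e B) →
      (∀ A, 0 ≤ f A) → (∀ A, f A ≤ 1) →
      (∀ A B : Finset ℤ, (∀ x, n ≤ x → (x ∈ A ↔ x ∈ B)) → f A = f B) →
      |(∑ A ∈ (Icc a b).powerset, e A * f A * axisWeight β a b T A) *
            ∑ A ∈ (Icc a b).powerset, axisWeight β a b T A -
          (∑ A ∈ (Icc a b).powerset, e A * axisWeight β a b T A) *
            ∑ A ∈ (Icc a b).powerset, f A * axisWeight β a b T A| ≤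
        δ * ((∑ A ∈ (Icc a b).powerset, e A * axisWeight β a b T A) *
          ∑ A ∈ (Icc a b).powerset, axisWeight β a b T A) := by
  have hβ0 : 0 ≤ β := (betaCrit_pos.trans hβ).le
  obtain ⟨C, r, hdec⟩ := exists_decayBound hβ
  obtain ⟨l, hl, hε⟩ := exists_gapError_le hdec (half_pos hδ)
  obtain ⟨k, hk⟩ := exists_pow_lt_of_lt_one (half_pos hδ)
    (show 1 - blockProb β l < 1 by linarith [blockProb_pos β l])
  refine ⟨k * l, fun n hn a b T hT ha hb e f he0 he hf0 hf1 hf => ?_⟩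
  push_cast at hn
  obtain ⟨lo, hlo⟩ := regeneration hβ hdec (a := a) (T := T) hT hl hf0 hf1 hf hb k (-1) ha
    (by linarith)
  have hkl : (0 : ℤ) ≤ k * l := by positivity
  have hsum : ∀ g : Finset ℤ → ℝ, ∑ A ∈ (Icc a b).powerset, g A * axisWeight β a b T A =
      ∑ A ∈ (Icc a (-1)).powerset, futureSum β a b T g (-1) A := fun g => by
    rw [sum_powerset_Icc (y := -1) (by omega) (by linarith)]; rfl
  have hesum : ∀ g : Finset ℤ → ℝ, ∑ A ∈ (Icc a b).powerset, e A * g A * axisWeight β a b T A =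
      ∑ A ∈ (Icc a (-1)).powerset, e A * futureSum β a b T g (-1) A := fun g => by
    rw [sum_powerset_Icc (y := -1) (by omega) (by linarith)]
    refine sum_congr rfl fun A _ => ?_
    rw [futureSum, mul_sum]
    refine sum_congr rfl fun B hB => ?_
    have hAB : ∀ x < 0, (x ∈ A ↔ x ∈ A ∪ B) := fun x hx => by
      have : x ∉ B := fun h => by
        have := mem_Icc.1 (mem_powerset.1 hB h); omega
      simp [this]
    rw [← he A (A ∪ B) hAB, mul_assoc]
  set M := fun A => futureSum β a b T (fun _ => 1) (-1) A with hM
  have hM0 : ∀ A, 0 ≤ M A := futureSum_one_nonneg β a b T (-1)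
  have h1 := hsum fun _ => 1
  have h2 := hesum fun _ => 1
  simp only [one_mul, mul_one] at h1 h2
  rw [h1, h2, hsum f, hesum f]
  set D := gapError C r l + (1 - blockProb β l) ^ k
  have hD : D ≤ δ := by simp only [D]; linarith
  have hA : ∀ A ∈ (Icc a (-1)).powerset, _ := fun A hA => hlo A (mem_powerset.1 hA)
  have f1 := sum_le_sum fun A h => (hA A h).1
  have f2 := sum_le_sum fun A h => (hA A h).2
  have e1 := sum_le_sum fun A h => mul_le_mul_of_nonneg_left (hA A h).1 (he0 A)
  have e2 := sum_le_sum fun A h => mul_le_mul_of_nonneg_left (hA A h).2 (he0 A)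
  simp only [mul_left_comm (e _)] at e1 e2
  rw [← mul_sum] at f1 f2 e1 e2
  set X := ∑ A ∈ (Icc a (-1)).powerset, futureSum β a b T (fun _ => 1) (-1) A
  set Xe := ∑ A ∈ (Icc a (-1)).powerset, e A * futureSum β a b T (fun _ => 1) (-1) A
  set Xf := ∑ A ∈ (Icc a (-1)).powerset, futureSum β a b T f (-1) A
  set Xef := ∑ A ∈ (Icc a (-1)).powerset, e A * futureSum β a b T f (-1) A
  have hX : 0 ≤ X := sum_nonneg fun A _ => hM0 A
  have hXe : 0 ≤ Xe := sum_nonneg fun A _ => mul_nonneg (he0 A) (hM0 A)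
  have g1 := mul_le_mul_of_nonneg_right e1 hX
  have g2 := mul_le_mul_of_nonneg_right e2 hX
  have g3 := mul_le_mul_of_nonneg_left f1 hXe
  have g4 := mul_le_mul_of_nonneg_left f2 hXe
  have g5 := mul_le_mul_of_nonneg_right hD (mul_nonneg hXe hX)
  rw [abs_le]
  constructor <;> linarith

end

end Schonmann

namespace Schonmann

open Finset hiding box
open scoped symmDiff

noncomputable section

theorem sum_Icc_reflect {M : Type*} [AddCommMonoid M] (c x y : ℤ) (g : ℤ → M) :
    ∑ i ∈ Icc (c - y) (c - x), g i = ∑ i ∈ Icc x y, g (c - i) := by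
  refine sum_nbij' (fun i => c - i) (fun i => c - i) ?_ ?_ ?_ ?_ ?_ <;>
    intro i hi <;> simp only [mem_Icc, sub_sub_cancel] at * <;> omega

theorem sum_Icc_split {M : Type*} [AddCommMonoid M] {x y w : ℤ} (h1 : x ≤ y + 1) (h2 : y ≤ w)
    (g : ℤ → M) : ∑ i ∈ Icc x w, g i = ∑ i ∈ Icc x y, g i + ∑ i ∈ Icc (y + 1) w, g i := by
  rw [← sum_union (disjoint_left.2 fun u => by simp only [mem_Icc]; omega)]
  congr 1; ext u; simp only [mem_Icc, mem_union]; omega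

theorem sum_Icc_symm {T : ℤ} (hT : 0 ≤ T) (g : ℤ → ℝ) :
    ∑ y ∈ Icc (-T) T, g y = g 0 + ∑ y ∈ Icc 1 T, g y + ∑ y ∈ Icc 1 T, g (-y) := by
  have h := sum_Icc_reflect 0 1 T g
  simp only [zero_sub] at h
  rw [sum_Icc_split (y := -1) (by omega) (by omega), sum_Icc_split (x := -1 + 1) (y := 0)
      (by omega) hT, h]
  simp; ring

theorem sum_Icc_symm' {T : ℤ} (hT : 0 ≤ T) (g : ℤ → ℝ) :
    ∑ y ∈ Icc (-T - 1) T, g y = ∑ y ∈ Icc 0 T, g y + ∑ y ∈ Icc 0 T, g (-1 - y) := by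
  rw [sum_Icc_split (y := -1) (by omega) (by omega), ← sum_Icc_reflect (-1) 0 T g, add_comm]
  congr 3; ring

theorem sum_nn_Icc {a b : ℤ} (hab : a ≤ b) (v : ℤ → ℝ) :
    ∑ x ∈ Icc a b, ((if x + 1 ≤ b then 1 / 2 else 1) * v x +
      (if a ≤ x - 1 then 1 / 2 else 1) * v (x - 1)) = ∑ x ∈ Icc (a - 1) b, v x := by
  have h1 : ∑ x ∈ Icc a b, (if x + 1 ≤ b then (1 / 2 : ℝ) else 1) * v x =
      (∑ x ∈ Icc a (b - 1), v x) / 2 + v b := by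
    rw [sum_Icc_split (y := b - 1) (by omega) (by omega), sub_add_cancel, Icc_self, sum_singleton,
      if_neg (by omega), one_mul, sum_div]
    congr 1
    refine sum_congr rfl fun x hx => ?_
    rw [mem_Icc] at hx
    rw [if_pos (by omega)]; ring
  have h2 : ∑ x ∈ Icc a b, (if a ≤ x - 1 then (1 / 2 : ℝ) else 1) * v (x - 1) =
      (∑ x ∈ Icc a (b - 1), v x) / 2 + v (a - 1) := by
    have hs : ∑ x ∈ Icc (a + 1) b, v (x - 1) = ∑ x ∈ Icc a (b - 1), v x :=
      sum_nbij' (· - 1) (· + 1) (by intro i; simp only [mem_Icc]; omega)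
        (by intro i; simp only [mem_Icc]; omega) (by simp) (by simp) (by simp)
    rw [sum_Icc_split (y := a) (by omega) (by omega), Icc_self, sum_singleton,
      if_neg (by omega), one_mul, ← hs, sum_div, add_comm]
    congr 1
    refine sum_congr rfl fun x hx => ?_
    rw [mem_Icc] at hx
    rw [if_pos (by omega)]; ring
  rw [sum_add_distrib, h1, h2, sum_Icc_split (x := a - 1) (y := a - 1) (by omega) (by omega),
    sub_add_cancel, Icc_self, sum_singleton, sum_Icc_split (x := a) (y := b - 1) (w := b) (by omega)
        (by omega),
    sub_add_cancel, Icc_self, sum_singleton]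
  ring

theorem sum_nbrs (x : ℤ × ℤ) (g : ℤ × ℤ → ℝ) :
    ∑ y ∈ nbrs x, g y = g (x.1 + 1, x.2) + g (x.1 - 1, x.2) +
      (g (x.1, x.2 + 1) + g (x.1, x.2 - 1)) := by
  unfold nbrs
  rw [sum_insert, sum_insert, sum_insert, sum_singleton]; · ring
  all_goals simp only [mem_insert, mem_singleton, Prod.mk.injEq]; omega

theorem isingWeight_zero_box (β : ℝ) (N : ℕ) (σ ω : Cfg2) (h : ∀ y ∉ box N, ω y = σ y) :
    isingWeight β 0 (box N) σ ω = Real.exp (β *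
      (∑ p ∈ Icc (-(N : ℤ) - 1) N ×ˢ Icc (-(N : ℤ)) N, sval (ω p) * sval (ω (p.1 + 1, p.2)) +
        ∑ p ∈ Icc (-(N : ℤ)) N ×ˢ Icc (-(N : ℤ) - 1) N, sval (ω p) * sval (ω (p.1, p.2 + 1)))) := by
  set u : ℤ × ℤ → ℝ := fun p => sval (ω p) with hu
  set c : ℤ × ℤ → ℝ := fun y => if y ∈ box N then 1 / 2 else 1 with hc
  have h1 : (∑ x ∈ box N, ∑ y ∈ (box N).filter (fun y => y ∈ nbrs x), sval (ω x) * sval (ω y)) / 2 +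
      ∑ x ∈ box N, ∑ y ∈ (nbrs x).filter (fun y => y ∉ box N), sval (ω x) * sval (σ y) =
      ∑ x ∈ box N, ∑ y ∈ nbrs x, c y * (u x * u y) := by
    rw [sum_div, ← sum_add_distrib]
    refine sum_congr rfl fun x _ => ?_
    have : (box N).filter (fun y => y ∈ nbrs x) = (nbrs x).filter (fun y => y ∈ box N) := by
      ext y; simp only [mem_filter]; tauto
    rw [this, ← sum_filter_add_sum_filter_not (nbrs x) (fun y => y ∈ box N), sum_div]
    congr 1 <;> refine sum_congr rfl fun y hy => ?_ <;> rw [mem_filter] at hy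
    · simp only [hc, hu]; rw [if_pos hy.2]; ring
    · simp only [hc, hu]; rw [if_neg hy.2, one_mul, h y hy.2]
  unfold isingWeight
  rw [h1, zero_mul, sub_zero]
  simp only [sum_nbrs]
  rw [sum_add_distrib]
  congr 3
  · rw [box, sum_product_right, sum_product_right]
    refine sum_congr rfl fun y hy => ?_
    rw [← sum_nn_Icc (by omega)]
    refine sum_congr rfl fun x hx => ?_
    rw [mem_Icc] at hx hy
    simp only [hc, box, mem_product, mem_Icc, sub_add_cancel]
    rw [mul_comm (u (x, y)) (u (x - 1, y))]
    congr 2 <;> congr 1 <;> apply propext <;> omega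
  · rw [box, sum_product, sum_product]
    refine sum_congr rfl fun x hx => ?_
    rw [← sum_nn_Icc (by omega)]
    refine sum_congr rfl fun y hy => ?_
    rw [mem_Icc] at hx hy
    simp only [hc, box, mem_product, mem_Icc, sub_add_cancel]
    rw [mul_comm (u (x, y)) (u (x, y - 1))]
    congr 2 <;> congr 1 <;> apply propext <;> omega

/-- The axis configuration with minus spins at `A`. -/
def axisCfg (A : Finset ℤ) : ZSeq Bool := fun i => decide (i ∉ A)

/-- The configuration with minus spins at `A` on the axis, `S` above it and the reflection of `S'`
below it. -/
def conf (A : Finset ℤ) (S S' : Finset (ℤ × ℤ)) : Cfg2 := fun p =>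
  if p.2 = 0 then axisCfg A p.1 else if 0 < p.2 then decide (p ∉ S) else decide ((p.1, -p.2) ∉ S')

theorem sval_decide_notMem {α : Type*} [DecidableEq α] (S : Finset α) (p : α) :
    sval (decide (p ∉ S)) = spn S p := by
  unfold sval spn; by_cases h : p ∈ S <;> simp [h]

theorem sval_conf_upper (A : Finset ℤ) (S S' : Finset (ℤ × ℤ)) (x : ℤ) {y : ℤ} (hy : 0 ≤ y) :
    sval (conf A S S' (x, y)) = glue (spn A) S (x, y) := by
  unfold conf glue
  by_cases h : y = 0
  · simp only [h, if_true, axisCfg, sval_decide_notMem]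
  · simp only [h, if_false, show 0 < y by omega, if_true, sval_decide_notMem]

theorem sval_conf_lower (A : Finset ℤ) (S S' : Finset (ℤ × ℤ)) (x : ℤ) {y : ℤ} (hy : 0 ≤ y) :
    sval (conf A S S' (x, -y)) = glue (spn A) S' (x, y) := by
  unfold conf glue
  by_cases h : y = 0
  · simp only [h, neg_zero, if_true, axisCfg, sval_decide_notMem]
  · simp only [neg_eq_zero, h, if_false, show ¬ 0 < -y by omega, neg_neg, sval_decide_notMem]

theorem sum_spn_mul_spn {a b : ℤ} {A : Finset ℤ} (hA : A ⊆ Icc a b) :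
    ∑ x ∈ Icc (a - 1) b, spn A x * spn A (x + 1) =
      (Icc (a - 1) b).card - 2 * (walls A).card := by
  have : ∀ x, spn A x * spn A (x + 1) = 1 - 2 * if x ∈ walls A then 1 else 0 := by
    intro x
    unfold spn
    by_cases h : x ∈ A <;> by_cases h' : x + 1 ∈ A <;> simp [mem_walls, h, h'] <;> norm_num
  simp only [this]
  rw [sum_sub_distrib, ← mul_sum, sum_ite_mem, inter_eq_right.2 (walls_subset hA)]
  simp

theorem isingWeight_conf (β : ℝ) (N : ℕ) {A : Finset ℤ} {S S' : Finset (ℤ × ℤ)}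
    (hA : A ⊆ Icc (-(N : ℤ)) N) (h : ∀ y ∉ box N, conf A S S' y = true) :
    isingWeight β 0 (box N) (fun _ => true) (conf A S S') =
      Real.exp (β * (Icc (-(N : ℤ) - 1) N).card) * (wallWeight β A *
        (Real.exp (β * energy (-N) N N (fun _ => 1) (glue (spn A) S)) *
          Real.exp (β * energy (-N) N N (fun _ => 1) (glue (spn A) S')))) := by
  have hN : (0 : ℤ) ≤ N := by positivity
  rw [isingWeight_zero_box β N _ _ h, wallWeight, ← Real.exp_add, ← Real.exp_add, ← Real.exp_add]
  congr 1
  have h0 : ∑ x ∈ Icc (-(N : ℤ) - 1) N, sval (conf A S S' (x, 0)) * sval (conf A S S' (x + 1, 0)) =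
      (Icc (-(N : ℤ) - 1) N).card - 2 * (walls A).card := by
    rw [← sum_spn_mul_spn hA]
    refine sum_congr rfl fun x _ => ?_
    rw [sval_conf_upper _ _ _ _ le_rfl, sval_conf_upper _ _ _ _ le_rfl]; simp [glue]
  have h1 : ∑ p ∈ Icc (-(N : ℤ) - 1) N ×ˢ Icc (-(N : ℤ)) N,
      sval (conf A S S' p) * sval (conf A S S' (p.1 + 1, p.2)) =
      ((Icc (-(N : ℤ) - 1) N).card - 2 * (walls A).card) +
      ∑ p ∈ Icc (-(N : ℤ) - 1) N ×ˢ Icc 1 (N : ℤ),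
        glue (spn A) S p * glue (spn A) S (p.1 + 1, p.2) +
      ∑ p ∈ Icc (-(N : ℤ) - 1) N ×ˢ Icc 1 (N : ℤ),
        glue (spn A) S' p * glue (spn A) S' (p.1 + 1, p.2) := by
    rw [sum_product_right, sum_Icc_symm hN, h0, sum_product_right, sum_product_right]
    congr 1
    · congr 1
      refine sum_congr rfl fun y hy => sum_congr rfl fun x _ => ?_
      have := (mem_Icc.1 hy).1
      rw [sval_conf_upper _ _ _ _ (by omega), sval_conf_upper _ _ _ _ (by omega)]
    · refine sum_congr rfl fun y hy => sum_congr rfl fun x _ => ?_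
      have := (mem_Icc.1 hy).1
      rw [sval_conf_lower _ _ _ _ (by omega), sval_conf_lower _ _ _ _ (by omega)]
  have h2 : ∑ p ∈ Icc (-(N : ℤ)) N ×ˢ Icc (-(N : ℤ) - 1) N,
      sval (conf A S S' p) * sval (conf A S S' (p.1, p.2 + 1)) =
      ∑ p ∈ Icc (-(N : ℤ)) N ×ˢ Icc 0 (N : ℤ),
        glue (spn A) S p * glue (spn A) S (p.1, p.2 + 1) +
      ∑ p ∈ Icc (-(N : ℤ)) N ×ˢ Icc 0 (N : ℤ),
        glue (spn A) S' p * glue (spn A) S' (p.1, p.2 + 1) := by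
    rw [sum_product_right, sum_Icc_symm' hN, sum_product_right, sum_product_right]
    congr 1
    · refine sum_congr rfl fun y hy => sum_congr rfl fun x _ => ?_
      have := (mem_Icc.1 hy).1
      rw [sval_conf_upper _ _ _ _ (by omega), sval_conf_upper _ _ _ _ (by omega)]
    · refine sum_congr rfl fun y hy => sum_congr rfl fun x _ => ?_
      have := (mem_Icc.1 hy).1
      rw [show -1 - y = -(y + 1) by ring, sval_conf_lower _ _ _ _ (by omega),
        show -(y + 1) + 1 = -y by ring, sval_conf_lower _ _ _ _ (by omega), mul_comm]
  rw [h1, h2]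
  unfold energy
  simp only [one_mul]
  ring

theorem isingWeight_pos (β h : ℝ) (Λ : Finset (ℤ × ℤ)) (σ ω : Cfg2) : 0 < isingWeight β h Λ σ ω :=
  Real.exp_pos _

theorem isingFV_real (β h : ℝ) (Λ : Finset (ℤ × ℤ)) (σ : Cfg2) (E : Set Cfg2) :
    (isingFV β h Λ σ).real E =
      (∑ τ : ↥Λ → Bool, E.indicator (isingWeight β h Λ σ) (fill Λ σ τ)) /
        ∑ τ : ↥Λ → Bool, isingWeight β h Λ σ (fill Λ σ τ) := by
  have h1 : ∀ τ : ↥Λ → Bool,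
      (ENNReal.ofReal (isingWeight β h Λ σ (fill Λ σ τ)) • Measure.dirac (fill Λ σ τ)) E =
        ENNReal.ofReal (E.indicator (isingWeight β h Λ σ) (fill Λ σ τ)) := by
    intro τ
    rw [Measure.smul_apply, Measure.dirac_apply, smul_eq_mul]
    by_cases hE : fill Λ σ τ ∈ E <;> simp [hE]
  unfold isingFV Measure.real
  rw [Measure.smul_apply, Measure.finsetSum_apply, smul_eq_mul, sum_congr rfl fun τ _ => h1 τ,
    ← ENNReal.ofReal_sum_of_nonneg fun τ _ => (isingWeight_pos _ _ _ _ _).le,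
    ← ENNReal.ofReal_sum_of_nonneg fun τ _ =>
      Set.indicator_nonneg (fun _ _ => (isingWeight_pos _ _ _ _ _).le) _,
    ENNReal.toReal_mul, ENNReal.toReal_inv, ENNReal.toReal_ofReal, ENNReal.toReal_ofReal,
    inv_mul_eq_div]
  · exact sum_nonneg fun τ _ => Set.indicator_nonneg (fun _ _ => (isingWeight_pos _ _ _ _ _).le) _
  · exact sum_nonneg fun τ _ => (isingWeight_pos _ _ _ _ _).le

theorem conf_eq_true {N : ℕ} {A : Finset ℤ} {S S' : Finset (ℤ × ℤ)} (hA : A ⊆ Icc (-(N : ℤ)) N)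
    (hS : S ⊆ rect (-N) N N) (hS' : S' ⊆ rect (-N) N N) {p : ℤ × ℤ} (hp : p ∉ box N) :
    conf A S S' p = true := by
  simp only [box, mem_product, mem_Icc] at hp
  have hN : (0 : ℤ) ≤ N := by positivity
  unfold conf axisCfg
  split_ifs with h1 h2
  · refine decide_eq_true fun h => ?_
    have := mem_Icc.1 (hA h); omega
  · refine decide_eq_true fun h => ?_
    have := hS h
    simp only [rect, mem_product, mem_Icc] at this; omega
  · refine decide_eq_true fun h => ?_
    have := hS' h
    simp only [rect, mem_product, mem_Icc] at this; omega

theorem fill_restrict_conf {N : ℕ} {A : Finset ℤ} {S S' : Finset (ℤ × ℤ)}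
    (hA : A ⊆ Icc (-(N : ℤ)) N) (hS : S ⊆ rect (-N) N N) (hS' : S' ⊆ rect (-N) N N) :
    fill (box N) (fun _ => true) (fun x => conf A S S' x) = conf A S S' := by
  funext p
  unfold fill
  split_ifs with h
  · rfl
  · exact (conf_eq_true hA hS hS' h).symm

theorem sum_fill_box (N : ℕ) (F : Cfg2 → ℝ) :
    ∑ τ : ↥(box N) → Bool, F (fill (box N) (fun _ => true) τ) =
      ∑ A ∈ (Icc (-(N : ℤ)) N).powerset, ∑ S ∈ (rect (-N) N N).powerset,
        ∑ S' ∈ (rect (-N) N N).powerset, F (conf A S S') := by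
  have hN : (0 : ℤ) ≤ N := by positivity
  simp only [← sum_product']
  symm
  refine sum_nbij' (fun t => fun x : ↥(box N) => conf t.1 t.2.1 t.2.2 x)
    (fun τ => ((Icc (-(N : ℤ)) N).filter fun x => fill (box N) (fun _ => true) τ (x, 0) = false,
      (rect (-N) N N).filter fun p => fill (box N) (fun _ => true) τ p = false,
      (rect (-N) N N).filter fun p => fill (box N) (fun _ => true) τ (p.1, -p.2) = false))
    (fun _ _ => mem_univ _) ?_ ?_ ?_ ?_
  · intro τ _; simp
  · rintro ⟨A, S, S'⟩ h
    simp only [mem_product, mem_powerset] at h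
    obtain ⟨hA, hS, hS'⟩ := h
    simp only [fill_restrict_conf hA hS hS', Prod.mk.injEq]
    refine ⟨?_, ?_, ?_⟩
    · ext x
      have := @hA x
      simp only [mem_filter, conf, axisCfg, if_true, decide_eq_false_iff_not, not_not]
      tauto
    · ext p
      have := @hS p
      simp only [mem_filter]
      constructor
      · rintro ⟨h1, h2⟩
        simp only [rect, mem_product, mem_Icc] at h1
        rw [conf, if_neg (by omega), if_pos (by omega)] at h2
        simpa using h2
      · intro h1
        refine ⟨this h1, ?_⟩
        have h2 := this h1
        simp only [rect, mem_product, mem_Icc] at h2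
        rw [conf, if_neg (by omega), if_pos (by omega)]
        simpa using h1
    · ext p
      have := @hS' p
      simp only [mem_filter]
      constructor
      · rintro ⟨h1, h2⟩
        simp only [rect, mem_product, mem_Icc] at h1
        rw [conf, if_neg (by simp only; omega), if_neg (by simp only; omega)] at h2
        simpa using h2
      · intro h1
        refine ⟨this h1, ?_⟩
        have h2 := this h1
        simp only [rect, mem_product, mem_Icc] at h2
        rw [conf, if_neg (by simp only; omega), if_neg (by simp only; omega)]
        simpa using h1
  · intro τ _
    funext ⟨p, hp⟩
    have hf : fill (box N) (fun _ => true) τ p = τ ⟨p, hp⟩ := by unfold fill; rw [dif_pos hp]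
    simp only [box, mem_product, mem_Icc] at hp
    obtain ⟨x, y⟩ := p
    simp only at hp
    unfold conf axisCfg
    simp only [mem_filter]
    split_ifs with h1 h2
    · subst h1
      rw [hf]
      cases hτ : τ ⟨(x, 0), _⟩ <;> simp [hp]
    · rw [hf]
      cases hτ : τ ⟨(x, y), _⟩ <;> simp [rect, hp]; omega
    · rw [neg_neg, hf]
      cases hτ : τ ⟨(x, y), _⟩ <;> simp [rect, hp]; omega
  · rintro ⟨A, S, S'⟩ h
    simp only [mem_product, mem_powerset] at h
    rw [fill_restrict_conf h.1 h.2.1 h.2.2]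

theorem lineProj_conf (A : Finset ℤ) (S S' : Finset (ℤ × ℤ)) : lineProj (conf A S S') =
    axisCfg A := by
  funext i; simp [lineProj, conf]

theorem sum_indicator_isingWeight (β : ℝ) (N : ℕ) (U : Set (ZSeq Bool)) :
    ∑ τ : ↥(box N) → Bool, (lineProj ⁻¹' U).indicator (isingWeight β 0 (box N) fun _ => true)
        (fill (box N) (fun _ => true) τ) =
      Real.exp (β * (Icc (-(N : ℤ) - 1) N).card) * ∑ A ∈ (Icc (-(N : ℤ)) N).powerset,
        U.indicator (fun _ => 1) (axisCfg A) * axisWeight β (-N) N N A := by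
  rw [sum_fill_box, mul_sum]
  refine sum_congr rfl fun A hA => ?_
  by_cases h : axisCfg A ∈ U
  · rw [Set.indicator_of_mem h, one_mul, axisWeight, sq, Z, sum_mul_sum, mul_sum, mul_sum]
    refine sum_congr rfl fun S hS => ?_
    rw [mul_sum, mul_sum]
    refine sum_congr rfl fun S' hS' => ?_
    rw [mem_powerset] at hA hS hS'
    rw [Set.indicator_of_mem (by rwa [Set.mem_preimage, lineProj_conf]),
      isingWeight_conf β N hA fun y hy => conf_eq_true hA hS hS' hy]
  · rw [Set.indicator_of_notMem h, zero_mul, mul_zero]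
    refine sum_eq_zero fun S _ => sum_eq_zero fun S' _ => ?_
    rw [Set.indicator_of_notMem (by rwa [Set.mem_preimage, lineProj_conf])]

/-- The axis marginal of the Ising measure in a box. -/
theorem isingFV_real_lineProj (β : ℝ) (N : ℕ) (U : Set (ZSeq Bool)) :
    (isingFV β 0 (box N) fun _ => true).real (lineProj ⁻¹' U) =
      (∑ A ∈ (Icc (-(N : ℤ)) N).powerset,
        U.indicator (fun _ => 1) (axisCfg A) * axisWeight β (-N) N N A) /
      ∑ A ∈ (Icc (-(N : ℤ)) N).powerset, axisWeight β (-N) N N A := by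
  have h := sum_indicator_isingWeight β N Set.univ
  simp only [Set.preimage_univ, Set.indicator_univ, one_mul] at h
  rw [isingFV_real, sum_indicator_isingWeight, h, mul_div_mul_left _ _ (Real.exp_pos _).ne']

/-- Uniform `φ`-mixing of the axis marginals of the Ising measures in boxes. -/
theorem exists_isingFV_mixing {β : ℝ} (hβ : betaCrit < β) {δ : ℝ} (hδ : 0 < δ) :
    ∃ n₀ : ℕ, ∀ n : ℕ, n₀ ≤ n → ∀ N : ℕ, 1 ≤ N → n ≤ N → ∀ U V : Set (ZSeq Bool),
      (∀ ω ω' : ZSeq Bool, (∀ x < 0, ω x = ω' x) → (ω ∈ U ↔ ω' ∈ U)) →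
      (∀ ω ω' : ZSeq Bool, (∀ x, (n : ℤ) ≤ x → ω x = ω' x) → (ω ∈ V ↔ ω' ∈ V)) →
      |(isingFV β 0 (box N) fun _ => true).real (lineProj ⁻¹' (U ∩ V)) -
          (isingFV β 0 (box N) fun _ => true).real (lineProj ⁻¹' U) *
            (isingFV β 0 (box N) fun _ => true).real (lineProj ⁻¹' V)| ≤
        δ * (isingFV β 0 (box N) fun _ => true).real (lineProj ⁻¹' U) := by
  obtain ⟨n₀, h⟩ := exists_axisWeight_mixing hβ hδ
  refine ⟨n₀, fun n hn N hN hnN U V hU hV => ?_⟩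
  have hcfg : ∀ {A B : Finset ℤ} {x : ℤ}, (x ∈ A ↔ x ∈ B) → axisCfg A x = axisCfg B x :=
    fun h => by simp [axisCfg, h]
  have hind : ∀ (W : Set (ZSeq Bool)) {A B : Finset ℤ}, (axisCfg A ∈ W ↔ axisCfg B ∈ W) →
      W.indicator (fun _ => (1 : ℝ)) (axisCfg A) = W.indicator (fun _ => (1 : ℝ)) (axisCfg B) :=
    fun W A B h => by
    by_cases hA : axisCfg A ∈ W
    · rw [Set.indicator_of_mem hA, Set.indicator_of_mem (h.1 hA)]
    · rw [Set.indicator_of_notMem hA, Set.indicator_of_notMem fun hB => hA (h.2 hB)]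
  have hnn : ∀ (W : Set (ZSeq Bool)) (A : Finset ℤ),
      0 ≤ W.indicator (fun _ => (1 : ℝ)) (axisCfg A) := fun W A =>
    Set.indicator_nonneg (fun _ _ => zero_le_one) _
  have key := h n (by exact_mod_cast hn) (-N) N N (by positivity) (by omega) (by exact_mod_cast hnN)
    (fun A => U.indicator (fun _ => 1) (axisCfg A)) (fun A => V.indicator (fun _ => 1) (axisCfg A))
    (hnn U) (fun A B hAB => hind U (hU _ _ fun x hx => hcfg (hAB x hx))) (hnn V)
    (fun A => Set.indicator_le' (fun _ _ => le_rfl) (fun _ _ => zero_le_one) _)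
    (fun A B hAB => hind V (hV _ _ fun x hx => hcfg (hAB x hx)))
  have hUV : ∀ A, U.indicator (fun _ => (1 : ℝ)) (axisCfg A) * V.indicator (fun _ => 1)
      (axisCfg A) =
      (U ∩ V).indicator (fun _ => 1) (axisCfg A) := fun A => by
    by_cases h1 : axisCfg A ∈ U <;> by_cases h2 : axisCfg A ∈ V <;> simp [h1, h2]
  simp only [hUV] at key
  simp only [isingFV_real_lineProj]
  have hX : 0 < ∑ A ∈ (Icc (-(N : ℤ)) N).powerset, axisWeight β (-N) N N A :=
    sum_pos (fun A _ => axisWeight_pos _ _ _ _ _) (powerset_nonempty _)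
  set X := ∑ A ∈ (Icc (-(N : ℤ)) N).powerset, axisWeight β (-N) N N A
  set Xu := ∑ A ∈ (Icc (-(N : ℤ)) N).powerset,
    U.indicator (fun _ => 1) (axisCfg A) * axisWeight β (-N) N N A
  set Xv := ∑ A ∈ (Icc (-(N : ℤ)) N).powerset,
    V.indicator (fun _ => 1) (axisCfg A) * axisWeight β (-N) N N A
  set Xuv := ∑ A ∈ (Icc (-(N : ℤ)) N).powerset,
    (U ∩ V).indicator (fun _ => 1) (axisCfg A) * axisWeight β (-N) N N A
  have e1 : Xuv / X - Xu / X * (Xv / X) = (Xuv * X - Xu * Xv) / X ^ 2 := by field_simp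
  have e2 : δ * (Xu / X) = δ * (Xu * X) / X ^ 2 := by field_simp
  rw [e1, e2, abs_div, abs_of_pos (pow_pos hX 2)]
  exact div_le_div_of_nonneg_right key (sq_nonneg X)

theorem measurableSet_of_finite_dep {ι : Type*} {s : Finset ι} {t : Set (ι → Bool)}
    (ht : ∀ ω ω', (∀ i ∈ s, ω i = ω' i) → (ω ∈ t ↔ ω' ∈ t)) : MeasurableSet t := by
  classical
  have : t = s.restrict ⁻¹' (s.restrict '' t) := by
    refine Set.Subset.antisymm (Set.subset_preimage_image _ _) fun ω ⟨ω', h', e⟩ => ?_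
    exact (ht _ _ fun i hi => congrFun e ⟨i, hi⟩).1 h'
  rw [this]
  exact s.measurable_restrict (Set.toFinite _).measurableSet

/-- Convergence on point cylinders gives convergence on all finitely determined events. -/
theorem tendsto_of_cylTendsto {ι : Type*} {μs : ℕ → Measure (ι → Bool)}
    {μ : Measure (ι → Bool)} (h : CylTendsto μs μ) {s : Finset ι} {t : Set (ι → Bool)}
    (ht : ∀ ω ω', (∀ i ∈ s, ω i = ω' i) → (ω ∈ t ↔ ω' ∈ t)) :
    Tendsto (fun n => μs n t) atTop (𝓝 (μ t)) := by
  classical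
  let ext (g : s → Bool) (i : ι) : Bool := if hi : i ∈ s then g ⟨i, hi⟩ else true
  let cyl (g : s → Bool) : Set (ι → Bool) := {η | ∀ i ∈ s, η i = ext g i}
  have hext : ∀ (g : s → Bool) (i : s), ext g i = g i := fun g i => by simp [ext]
  have hcyl : ∀ g, MeasurableSet (cyl g) := fun g =>
    measurableSet_of_finite_dep (s := s) fun ω ω' e =>
      forall₂_congr fun i hi => by rw [e i hi]
  have hdisj : (univ.filter fun g => ext g ∈ t : Set (s → Bool)).PairwiseDisjoint cyl := by
    intro g _ g' _ hne
    refine Set.disjoint_left.2 fun η h1 h2 => hne (funext fun i => ?_)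
    rw [← hext g, ← hext g', ← h1 i i.2, ← h2 i i.2]
  have hunion : t = ⋃ g ∈ univ.filter fun g => ext g ∈ t, cyl g := by
    ext η
    simp only [mem_filter, mem_univ, true_and, Set.mem_iUnion, exists_prop]
    have hη' := hext fun i => η i
    refine ⟨fun hη => ⟨fun i => η i, ?_, fun i hi => ?_⟩, fun ⟨g, hg, hη⟩ => (ht _ _ hη).2 hg⟩
    · exact (ht _ _ fun i hi => (hη' ⟨i, hi⟩).symm).1 hη
    · exact (hη' ⟨i, hi⟩).symm
  have hsum : ∀ ν : Measure (ι → Bool),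
      ν t = ∑ g ∈ univ.filter fun g => ext g ∈ t, ν (cyl g) := fun ν => by
    conv_lhs => rw [hunion]
    exact measure_biUnion_finset (by simpa using hdisj) fun g _ => hcyl g
  simp only [hsum]
  exact tendsto_finsetSum _ fun g _ => h s (ext g)

/-- Events in the `σ`-algebra of the coordinates in `S` are approximated by events depending on
finitely many coordinates in `S`. -/
theorem exists_finite_dep_approx {ι : Type*} (ν : Measure (ι → Bool)) [IsFiniteMeasure ν]
    {S : Set ι} {A : Set (ι → Bool)} (hA : MeasurableSet[sigmaOn S] A) {ε : ℝ} (hε : 0 < ε) :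
    ∃ (s : Finset ι) (A' : Set (ι → Bool)), (∀ i ∈ s, i ∈ S) ∧
      (∀ ω ω', (∀ i ∈ s, ω i = ω' i) → (ω ∈ A' ↔ ω' ∈ A')) ∧ ν.real (A ∆ A') < ε := by
  classical
  obtain ⟨A₀, hA₀, rfl⟩ := hA
  have hS : Measurable (S.domRestrict : (ι → Bool) → S → Bool) := Set.measurable_restrict S
  have halg : IsSetAlgebra (measurableCylinders fun _ : S => Bool) :=
    ⟨empty_mem_measurableCylinders _, fun _ => compl_mem_measurableCylinders,
      fun _ _ => union_mem_measurableCylinders⟩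
  obtain ⟨t, ht, hlt⟩ := (Measure.MeasureDense.of_generateFrom_isSetAlgebra_finite
    (μ := ν.map S.domRestrict) halg generateFrom_measurableCylinders.symm).approx A₀ hA₀
    (measure_ne_top _ _) ε hε
  have htm := MeasurableSet.of_mem_measurableCylinders ht
  obtain ⟨s, T, -, rfl⟩ := (mem_measurableCylinders _).1 ht
  refine ⟨s.image Subtype.val, S.domRestrict ⁻¹' cylinder s T, by simp +contextual,
    fun ω ω' e => ?_, ?_⟩
  · have : s.restrict (S.domRestrict ω) = s.restrict (S.domRestrict ω') :=
      funext fun i => e i.1 (mem_image_of_mem _ i.2)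
    simp only [Set.mem_preimage, mem_cylinder, this]
  · rw [Measure.map_apply hS (hA₀.symmDiff htm)] at hlt
    have := (ENNReal.toReal_lt_toReal (measure_ne_top _ _) ENNReal.ofReal_ne_top).2 hlt
    rwa [ENNReal.toReal_ofReal hε.le] at this

theorem sigmaOn_le {ι : Type*} (S : Set ι) :
    (sigmaOn S : MeasurableSpace (ι → Bool)) ≤ MeasurableSpace.pi :=
  (Set.measurable_restrict S).comap_le

theorem measurable_lineProj : Measurable lineProj :=
  measurable_pi_lambda _ fun _ => measurable_pi_apply _

theorem measureReal_abs_sub_le {X : Type*} [MeasurableSpace X] (ν : Measure X) [IsFiniteMeasure ν]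
    {s t u : Set X} (h : s ∆ t ⊆ u) : |ν.real s - ν.real t| ≤ ν.real u := by
  have h1 : s ⊆ t ∪ u := fun x hx => by
    by_cases hxt : x ∈ t
    · exact .inl hxt
    · exact .inr (h (.inl ⟨hx, hxt⟩))
  have h2 : t ⊆ s ∪ u := fun x hx => by
    by_cases hxs : x ∈ s
    · exact .inl hxs
    · exact .inr (h (.inr ⟨hx, hxs⟩))
  have h1' := (measureReal_mono (μ := ν) h1).trans (measureReal_union_le _ _)
  have h2' := (measureReal_mono (μ := ν) h2).trans (measureReal_union_le _ _)
  exact abs_sub_le_iff.2 ⟨by linarith, by linarith⟩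

theorem schonmann_real_finite_dep {β : ℝ} {μp : Measure Cfg2} (hμp : IsPlusPhase β 0 μp)
    {s : Finset ℤ} {U : Set (ZSeq Bool)}
    (hU : ∀ ω ω', (∀ i ∈ s, ω i = ω' i) → (ω ∈ U ↔ ω' ∈ U)) :
    Tendsto (fun N => (isingFV β 0 (box N) fun _ => true).real (lineProj ⁻¹' U)) atTop
      (𝓝 ((schonmann μp).real U)) := by
  have := hμp.1
  have hlim := tendsto_of_cylTendsto hμp.2 (s := s.image fun i => (i, 0)) (t := lineProj ⁻¹' U)
    fun ω ω' e => hU _ _ fun i hi => e _ (mem_image_of_mem _ hi)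
  rw [Measure.real, schonmann, Measure.map_apply measurable_lineProj (measurableSet_of_finite_dep hU)]
  exact (ENNReal.tendsto_toReal (measure_ne_top _ _)).comp hlim

/-- Mixing of the Schonmann projection on finitely determined events. -/
theorem exists_schonmann_mixing_finite_dep {β : ℝ} (hβ : betaCrit < β) {μp : Measure Cfg2}
    (hμp : IsPlusPhase β 0 μp) {δ : ℝ} (hδ : 0 < δ) :
    ∃ n₀ : ℕ, ∀ n : ℕ, n₀ ≤ n → ∀ (s r : Finset ℤ) (U V : Set (ZSeq Bool)),
      (∀ i ∈ s, i < 0) → (∀ i ∈ r, (n : ℤ) ≤ i) →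
      (∀ ω ω', (∀ i ∈ s, ω i = ω' i) → (ω ∈ U ↔ ω' ∈ U)) →
      (∀ ω ω', (∀ i ∈ r, ω i = ω' i) → (ω ∈ V ↔ ω' ∈ V)) →
      |(schonmann μp).real (U ∩ V) - (schonmann μp).real U * (schonmann μp).real V| ≤
        δ * (schonmann μp).real U := by
  obtain ⟨n₀, h⟩ := exists_isingFV_mixing hβ hδ
  refine ⟨n₀, fun n hn s r U V hs hr hU hV => ?_⟩
  have hUV : ∀ ω ω', (∀ i ∈ s ∪ r, ω i = ω' i) → (ω ∈ U ∩ V ↔ ω' ∈ U ∩ V) := fun ω ω' e =>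
    and_congr (hU _ _ fun i hi => e i (mem_union_left _ hi))
      (hV _ _ fun i hi => e i (mem_union_right _ hi))
  have lU := schonmann_real_finite_dep hμp hU
  refine le_of_tendsto_of_tendsto
    ((schonmann_real_finite_dep hμp hUV).sub (lU.mul (schonmann_real_finite_dep hμp hV))).abs
    (lU.const_mul δ) ?_
  filter_upwards [eventually_ge_atTop (max 1 n)] with N hN
  exact h n hn N (le_of_max_le_left hN) (le_of_max_le_right hN) U V
    (fun ω ω' e => hU ω ω' fun i hi => e i (hs i hi))
    (fun ω ω' e => hV ω ω' fun i hi => e i (hr i hi))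

/-- Mixing of the Schonmann projection on all past and future events. -/
theorem exists_schonmann_mixing {β : ℝ} (hβ : betaCrit < β) {μp : Measure Cfg2}
    (hμp : IsPlusPhase β 0 μp) {δ : ℝ} (hδ : 0 < δ) :
    ∃ n₀ : ℕ, ∀ n : ℕ, n₀ ≤ n → ∀ A B : Set (ZSeq Bool),
      MeasurableSet[sigmaOn {i : ℤ | i < 0}] A → MeasurableSet[sigmaOn {i : ℤ | (n : ℤ) ≤ i}] B →
      |(schonmann μp).real (A ∩ B) - (schonmann μp).real A * (schonmann μp).real B| ≤
        δ * (schonmann μp).real A := by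
  obtain ⟨n₀, h⟩ := exists_schonmann_mixing_finite_dep hβ hμp hδ
  refine ⟨n₀, fun n hn A B hA hB => ?_⟩
  have := hμp.1
  have : IsProbabilityMeasure (schonmann μp) :=
    Measure.isProbabilityMeasure_map measurable_lineProj.aemeasurable
  set ν := schonmann μp
  refine le_of_forall_pos_le_add fun ε hε => ?_
  obtain ⟨s, U, hs, hU, hAU⟩ := exists_finite_dep_approx ν hA (ε := ε / (4 + δ)) (by positivity)
  obtain ⟨r, V, hr, hV, hBV⟩ := exists_finite_dep_approx ν hB (ε := ε / (4 + δ)) (by positivity)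
  have key := h n hn s r U V hs hr hU hV
  set e := ε / (4 + δ)
  have he : ε = (4 + δ) * e := by simp only [e]; field_simp
  have dA := (measureReal_abs_sub_le ν (subset_refl (A ∆ U))).trans hAU.le
  have dB := (measureReal_abs_sub_le ν (subset_refl (B ∆ V))).trans hBV.le
  have hsub : (A ∩ B) ∆ (U ∩ V) ⊆ A ∆ U ∪ B ∆ V := fun x hx => by
    simp only [Set.mem_symmDiff, Set.mem_inter_iff, Set.mem_union] at hx ⊢
    tauto
  have dAB := (measureReal_abs_sub_le ν hsub).trans (measureReal_union_le _ _)
  have hA1 : ν.real A ≤ 1 := measureReal_le_one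
  have hV1 : ν.real V ≤ 1 := measureReal_le_one
  have hA0 : 0 ≤ ν.real A := measureReal_nonneg
  have hV0 : 0 ≤ ν.real V := measureReal_nonneg
  have p1 : |ν.real A * (ν.real B - ν.real V)| ≤ e := by
    rw [abs_mul, abs_of_nonneg hA0]
    exact (mul_le_of_le_one_left (abs_nonneg _) hA1).trans dB
  have p2 : |(ν.real A - ν.real U) * ν.real V| ≤ e := by
    rw [abs_mul, abs_of_nonneg hV0]
    exact (mul_le_of_le_one_right (abs_nonneg _) hV1).trans dA
  have p3 : δ * ν.real U ≤ δ * ν.real A + δ * e := by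
    rw [← mul_add]
    exact mul_le_mul_of_nonneg_left (by linarith [(abs_le.1 dA).1]) hδ.le
  rw [abs_le] at *
  constructor <;> nlinarith [dAB.1, dAB.2, p1.1, p1.2, p2.1, p2.2, key.1, key.2]

theorem condProbR_eq_div {X : Type*} [MeasurableSpace X] (μ : Measure X) {A : Set X}
    (hA : MeasurableSet A) (B : Set X) : condProbR μ B A = μ.real (A ∩ B) / μ.real A := by
  rw [condProbR, cond_apply hA, ENNReal.toReal_mul, ENNReal.toReal_inv, div_eq_inv_mul]
  rfl

end

end Schonmann

open Schonmann in
/-- For `h = 0` and `β > β_c` the Schonmann projection is φ-mixing: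
`sup_{B ∈ ℱ_{≥n}} sup_{A ∈ ℱ_{<0}, ν(A)>0} |ν(B|A) − ν(B)| → 0` as `n → ∞`. -/
theorem schonmann_phi_mixing
    (β : ℝ) (hβ : betaCrit < β) (μp : Measure Cfg2) (hμp : IsPlusPhase β 0 μp) :
    Tendsto (fun n : ℕ => sSup {d : ℝ | ∃ A B : Set (ZSeq Bool),
        MeasurableSet[sigmaOn {i : ℤ | i < 0}] A ∧
        MeasurableSet[sigmaOn {i : ℤ | (n : ℤ) ≤ i}] B ∧
        0 < schonmann μp A ∧
        d = |condProbR (schonmann μp) B A - ((schonmann μp) B).toReal|})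
      atTop (𝓝 0) := by
  have := hμp.1
  have : IsProbabilityMeasure (schonmann μp) :=
    Measure.isProbabilityMeasure_map measurable_lineProj.aemeasurable
  refine Metric.tendsto_atTop.2 fun ε hε => ?_
  obtain ⟨n₀, h⟩ := exists_schonmann_mixing hβ hμp (half_pos hε)
  refine ⟨n₀, fun n hn => ?_⟩
  rw [Real.dist_0_eq_abs, abs_of_nonneg (Real.sSup_nonneg ?_)]
  · refine (Real.sSup_le ?_ (half_pos hε).le).trans_lt (half_lt_self hε)
    rintro d ⟨A, B, hA, hB, hpos, rfl⟩
    have hpos' : 0 < (schonmann μp).real A := ENNReal.toReal_pos hpos.ne' (measure_ne_top _ _)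
    rw [condProbR_eq_div _ (sigmaOn_le _ _ hA), ← Measure.real, div_sub' hpos'.ne', abs_div,
      abs_of_pos hpos', div_le_iff₀ hpos']
    exact h n hn A B hA hB
  · rintro d ⟨A, B, -, -, -, rfl⟩
    exact abs_nonneg _
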